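/- arXiv:math/0505578 — 7 statements merged into one kernel-verified Lean document; each statement's English description precedes it below -/
import Mathlib

section
/- Let U ⊆ ℂ^N be open, G₁,…,G_s : U → ℂ holomorphic (1 ≤ s ≤ N), V₁ = {x ∈ U : G₁(x) = … = G_s(x) = 0}, and suppose the s×s matrix A(x) = (∂G_i/∂x^j(x))_{1≤i,j≤s} is invertible on U, with inverse entries A^{ji} = (A⁻¹)_{ji}. Let W ⊆ ℂ^{N−s} be open and f = (f₁,…,f_s) : W → ℂ^s holomorphic with ψ(w) = (f₁(w),…,f_s(w), w) ∈ V₁ for all w ∈ W. Let X̃ = (X̃¹,…,X̃^N) : U → ℂ^N be holomorphic with X̃G_i := Σ_{k=1}^N X̃^k ∂G_i/∂x^k vanishing identically on V₁ (X̃ is tangent to V₁), and define X^i(w) = X̃^i(ψ(w)) for s+1 ≤ i ≤ N. Then for every w ∈ W: Σ_{i=s+1}^N ∂X^i/∂w^i(w) − (Σ_{k=1}^N X̃^k ∂(det A)/∂x^k)(ψ(w)) / det A(ψ(w)) = Σ_{i=1}^N ∂X̃^i/∂x^i(ψ(w)) − Σ_{i,j=1}^s A^{ji}(ψ(w)) ∂(X̃G_i)/∂x^j(ψ(w)).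 -/
open scoped BigOperators

lemma det_updateRow_adj {s : ℕ} (M : Matrix (Fin s) (Fin s) ℂ) (i : Fin s) (b : Fin s → ℂ) :
    (M.updateRow i b).det = ∑ j, M.adjugate j i * b j := by
  rw [← Matrix.cramer_transpose_apply, Matrix.cramer_eq_adjugate_mulVec,
    ← Matrix.adjugate_transpose]
  rfl

lemma jacobi_fderiv {E : Type*} [NormedAddCommGroup E] [NormedSpace ℂ E] {s : ℕ}
    (A : E → Matrix (Fin s) (Fin s) ℂ) (p v : E)
    (hA : ∀ i j, DifferentiableAt ℂ (fun x => A x i j) p) :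
    fderiv ℂ (fun x => (A x).det) p v =
      ∑ i, ∑ j, (A p).adjugate j i * fderiv ℂ (fun x => A x i j) p v := by
  let D : ContinuousMultilinearMap ℂ (fun _ : Fin s => (Fin s → ℂ)) ℂ :=
    { (Matrix.detRowAlternating (n := Fin s) (R := ℂ)).toMultilinearMap with
      cont := by
        show Continuous fun M : Matrix (Fin s) (Fin s) ℂ => M.det
        exact Continuous.matrix_det continuous_id }
  have hrow : ∀ i, HasFDerivAt (fun x => A x i)
      (ContinuousLinearMap.pi fun j => fderiv ℂ (fun x => A x i j) p) p := by
    intro i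
    rw [hasFDerivAt_pi]
    exact fun j => (hA i j).hasFDerivAt
  have h := HasFDerivAt.multilinear_comp (f := D) hrow
  have h2 : HasFDerivAt (fun x => (A x).det) _ p := h
  rw [h2.fderiv]
  simp only [_root_.sum_apply, ContinuousLinearMap.comp_apply]
  refine Finset.sum_congr rfl fun i _ => ?_
  exact det_updateRow_adj (A p) i _

lemma clm_append {s t : ℕ} (L : (Fin (s + t) → ℂ) →L[ℂ] ℂ) (v : Fin (s + t) → ℂ) :
    L v = ∑ j : Fin s, v (Fin.castAdd t j) * L (Pi.single (Fin.castAdd t j) 1)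
      + ∑ l : Fin t, v (Fin.natAdd s l) * L (Pi.single (Fin.natAdd s l) 1) := by
  rw [← Fin.sum_univ_add (fun k => v k * L (Pi.single k 1))]
  conv_lhs => rw [pi_eq_sum_univ' v]
  simp

/-- **Lemma 4.2 of the paper** (the elementary divergence identity used in the
computation of the Futaki invariant of complete intersections).

Points of `ℂ^N` are modelled as `Fin (s + t) → ℂ` (so `N = s + t`, the first `s`
coordinates are `x^1, …, x^s` and the last `t = N - s` ones correspond to the
coordinates `w^{s+1}, …, w^N` of `ℂ^{N-s}`).  `V₁ = {x ∈ U | G₁ x = ⋯ = G_s x = 0}`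
is parametrized by `ψ w = (f₁ w, …, f_s w, w)`, `A x = (∂G_i/∂x^j)_{1≤i,j≤s}` is
invertible on `U`, `Xt k = X̃^k` are the components of a holomorphic vector field
tangent to `V₁` (i.e. `X̃G_i := Σ_k X̃^k ∂G_i/∂x^k` vanishes on `V₁`), and
`X^i(w) = X̃^i(ψ w)` for `s+1 ≤ i ≤ N`.  Then on `W`:
`Σ_{i>s} ∂X^i/∂w^i - (X̃ (det A))/(det A) ∘ ψ
  = Σ_{i=1}^N ∂X̃^i/∂x^i ∘ ψ - Σ_{i,j≤s} (A⁻¹)_{ji} ∂(X̃G_i)/∂x^j ∘ ψ`. -/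
theorem divergence_identity_on_complete_intersection
    (s t : ℕ) (hs : 1 ≤ s)
    (U : Set (Fin (s + t) → ℂ)) (hU : IsOpen U)
    (G : Fin s → (Fin (s + t) → ℂ) → ℂ)
    (hG : ∀ i, AnalyticOnNhd ℂ (G i) U)
    (A : (Fin (s + t) → ℂ) → Matrix (Fin s) (Fin s) ℂ)
    (hA : ∀ x, A x = Matrix.of fun i j =>
      fderiv ℂ (G i) x (Pi.single (Fin.castAdd t j) 1))
    (hAinv : ∀ x ∈ U, IsUnit (A x).det)
    (W : Set (Fin t → ℂ)) (hW : IsOpen W)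
    (f : Fin s → (Fin t → ℂ) → ℂ)
    (hf : ∀ j, AnalyticOnNhd ℂ (f j) W)
    (ψ : (Fin t → ℂ) → (Fin (s + t) → ℂ))
    (hψ : ∀ w, ψ w = Fin.append (fun i => f i w) w)
    (hψU : ∀ w ∈ W, ψ w ∈ U)
    (hψV : ∀ w ∈ W, ∀ i, G i (ψ w) = 0)
    (Xt : Fin (s + t) → (Fin (s + t) → ℂ) → ℂ)
    (hXt : ∀ k, AnalyticOnNhd ℂ (Xt k) U)
    (XG : Fin s → (Fin (s + t) → ℂ) → ℂ)
    (hXG : ∀ i x, XG i x = ∑ k, Xt k x * fderiv ℂ (G i) x (Pi.single k 1))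
    (htangent : ∀ x ∈ U, (∀ i, G i x = 0) → ∀ i, XG i x = 0) :
    ∀ w ∈ W,
      (∑ i : Fin t,
          fderiv ℂ (fun w' => Xt (Fin.natAdd s i) (ψ w')) w (Pi.single i 1))
        - (∑ k, Xt k (ψ w) *
              fderiv ℂ (fun y => (A y).det) (ψ w) (Pi.single k 1)) / (A (ψ w)).det
      = (∑ i : Fin (s + t), fderiv ℂ (Xt i) (ψ w) (Pi.single i 1))
        - ∑ i : Fin s, ∑ j : Fin s, (A (ψ w))⁻¹ j i *
            fderiv ℂ (XG i) (ψ w) (Pi.single (Fin.castAdd t j) 1) := by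
  intro w hw
  have hpU := hψU w hw
  have hGd : ∀ i, DifferentiableAt ℂ (G i) (ψ w) := fun i => (hG i _ hpU).differentiableAt
  have hG2 : ∀ i, DifferentiableAt ℂ (fderiv ℂ (G i)) (ψ w) :=
    fun i => (hG i _ hpU).fderiv.differentiableAt
  have hXd : ∀ k, DifferentiableAt ℂ (Xt k) (ψ w) := fun k => (hXt k _ hpU).differentiableAt
  have hfd : ∀ j, DifferentiableAt ℂ (f j) w := fun j => (hf j _ hw).differentiableAt
  have hsymm : ∀ i u v, fderiv ℂ (fderiv ℂ (G i)) (ψ w) u v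
      = fderiv ℂ (fderiv ℂ (G i)) (ψ w) v u := fun i =>
    (hG i _ hpU).contDiffAt.isSymmSndFDerivAt_of_omega
  have hG2' : ∀ i u v, HasFDerivAt (fun x => fderiv ℂ (G i) x u)
      ((fderiv ℂ (fderiv ℂ (G i)) (ψ w)).flip u) (ψ w) ∧
      ((fderiv ℂ (fderiv ℂ (G i)) (ψ w)).flip u) v = fderiv ℂ (fderiv ℂ (G i)) (ψ w) v u := by
    intro i u v
    refine ⟨?_, rfl⟩
    have := (hG2 i).hasFDerivAt.clm_apply (hasFDerivAt_const u (ψ w))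
    simpa using this
  -- derivative of ψ
  have hψd : HasFDerivAt ψ (ContinuousLinearMap.pi
      (Fin.append (fun j => fderiv ℂ (f j) w) fun l => ContinuousLinearMap.proj l)) w := by
    have h0 : ψ = fun y k => ψ y k := rfl
    rw [h0, hasFDerivAt_pi]
    intro k
    refine Fin.addCases (fun j => ?_) (fun l => ?_) k
    · have h1 : (fun y => ψ y (Fin.castAdd t j)) = f j := by funext y; simp [hψ]
      rw [h1, Fin.append_left]
      exact (hfd j).hasFDerivAt
    · have h1 : (fun y => ψ y (Fin.natAdd s l)) = fun y => y l := by funext y; simp [hψ]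
      rw [h1, Fin.append_right]
      exact (ContinuousLinearMap.proj (R := ℂ) (φ := fun _ : Fin t => ℂ) l).hasFDerivAt
  have hchain : ∀ (F : (Fin (s + t) → ℂ) → ℂ), DifferentiableAt ℂ F (ψ w) → ∀ l : Fin t,
      fderiv ℂ (fun y => F (ψ y)) w (Pi.single l 1)
        = ∑ j, fderiv ℂ (f j) w (Pi.single l 1) * fderiv ℂ F (ψ w) (Pi.single (Fin.castAdd t j) 1)
          + fderiv ℂ F (ψ w) (Pi.single (Fin.natAdd s l) 1) := by
    intro F hF l
    have h1 : HasFDerivAt (fun y => F (ψ y)) _ w := hF.hasFDerivAt.comp w hψd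
    rw [h1.fderiv, ContinuousLinearMap.comp_apply, clm_append]
    simp [Pi.single_apply]
  -- implicit differentiation
  have himp : ∀ i l, fderiv ℂ (G i) (ψ w) (Pi.single (Fin.natAdd s l) 1)
      = - ∑ j, A (ψ w) i j * fderiv ℂ (f j) w (Pi.single l 1) := by
    intro i l
    have h0 : (fun y => G i (ψ y)) =ᶠ[nhds w] fun _ => 0 := by
      filter_upwards [hW.mem_nhds hw] with y hy using hψV y hy i
    have h1 := hchain (G i) (hGd i) l
    rw [h0.fderiv_eq] at h1
    simp only [hA, Matrix.of_apply]
    simp only [fderiv_fun_const, Pi.zero_apply, ContinuousLinearMap.zero_apply] at h1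
    rw [eq_neg_iff_add_eq_zero, h1, add_comm]
    simp only [mul_comm]
  have hdet := hAinv _ hpU
  have hinvA : (A (ψ w))⁻¹ * A (ψ w) = 1 := Matrix.nonsing_inv_mul _ hdet
  have hinv1 : ∀ j k, ∑ i, (A (ψ w))⁻¹ j i * A (ψ w) i k = if j = k then 1 else 0 := by
    intro j k
    have := congrFun (congrFun hinvA j) k
    rwa [Matrix.mul_apply, Matrix.one_apply] at this
  have himp2 : ∀ j l, ∑ i, (A (ψ w))⁻¹ j i * fderiv ℂ (G i) (ψ w) (Pi.single (Fin.natAdd s l) 1)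
      = - fderiv ℂ (f j) w (Pi.single l 1) := by
    intro j l
    simp only [himp, mul_neg, Finset.sum_neg_distrib, Finset.mul_sum, ← mul_assoc]
    rw [Finset.sum_comm]
    simp only [← Finset.sum_mul, hinv1]
    simp
  have hAgen : ∀ i j, A (ψ w) i j = fderiv ℂ (G i) (ψ w) (Pi.single (Fin.castAdd t j) 1) := by
    intro i j; simp [hA]
  -- derivative of A
  have hAd : ∀ i j, HasFDerivAt (fun x => A x i j)
      ((fderiv ℂ (fderiv ℂ (G i)) (ψ w)).flip (Pi.single (Fin.castAdd t j) 1)) (ψ w) := by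
    intro i j
    have := (hG2' i (Pi.single (Fin.castAdd t j) 1) 0).1
    simpa only [hA, Matrix.of_apply] using this
  have hdetd : (∑ k, Xt k (ψ w) *
              fderiv ℂ (fun y => (A y).det) (ψ w) (Pi.single k 1)) / (A (ψ w)).det
      = ∑ i, ∑ j, (A (ψ w))⁻¹ j i * ∑ k, Xt k (ψ w) *
          fderiv ℂ (fderiv ℂ (G i)) (ψ w) (Pi.single (Fin.castAdd t j) 1) (Pi.single k 1) := by
    simp only [jacobi_fderiv A (ψ w) _ fun i j => (hAd i j).differentiableAt,
      fun i j => (hAd i j).fderiv, ContinuousLinearMap.flip_apply, Matrix.inv_def,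
      Ring.inverse_eq_inv', Matrix.smul_apply, smul_eq_mul, Finset.mul_sum, Finset.sum_div]
    rw [Finset.sum_comm]
    refine Finset.sum_congr rfl fun i _ => ?_
    rw [Finset.sum_comm]
    refine Finset.sum_congr rfl fun j _ => ?_
    refine Finset.sum_congr rfl fun k _ => ?_
    rw [hsymm i (Pi.single k 1)]
    ring
  have hXGd : ∀ i v, fderiv ℂ (XG i) (ψ w) v
      = ∑ k, fderiv ℂ (Xt k) (ψ w) v * fderiv ℂ (G i) (ψ w) (Pi.single k 1)
        + ∑ k, Xt k (ψ w) * fderiv ℂ (fderiv ℂ (G i)) (ψ w) v (Pi.single k 1) := by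
    intro i v
    have h1 : XG i = fun x => ∑ k, Xt k x * fderiv ℂ (G i) x (Pi.single k 1) := funext (hXG i)
    have h2 := HasFDerivAt.fun_sum (u := Finset.univ) fun k _ =>
      (hXd k).hasFDerivAt.mul (hG2' i (Pi.single k 1) 0).1
    rw [h1]
    erw [h2.fderiv]
    rw [← Finset.sum_add_distrib, _root_.sum_apply]
    refine Finset.sum_congr rfl fun k _ => ?_
    simp
    ring
  have hmain : ∑ i : Fin s, ∑ j : Fin s, (A (ψ w))⁻¹ j i *
        ∑ k, fderiv ℂ (Xt k) (ψ w) (Pi.single (Fin.castAdd t j) 1) *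
          fderiv ℂ (G i) (ψ w) (Pi.single k 1)
      = ∑ j : Fin s, fderiv ℂ (Xt (Fin.castAdd t j)) (ψ w) (Pi.single (Fin.castAdd t j) 1)
        - ∑ l : Fin t, ∑ j : Fin s, fderiv ℂ (f j) w (Pi.single l 1) *
          fderiv ℂ (Xt (Fin.natAdd s l)) (ψ w) (Pi.single (Fin.castAdd t j) 1) := by
    rw [Finset.sum_comm, Finset.sum_comm (γ := Fin t), ← Finset.sum_sub_distrib]
    refine Finset.sum_congr rfl fun j _ => ?_
    simp only [Finset.mul_sum]
    rw [Finset.sum_comm]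
    have h1 : ∀ k, ∑ i, (A (ψ w))⁻¹ j i *
        (fderiv ℂ (Xt k) (ψ w) (Pi.single (Fin.castAdd t j) 1) *
          fderiv ℂ (G i) (ψ w) (Pi.single k 1))
        = fderiv ℂ (Xt k) (ψ w) (Pi.single (Fin.castAdd t j) 1) *
          ∑ i, (A (ψ w))⁻¹ j i * fderiv ℂ (G i) (ψ w) (Pi.single k 1) := by
      intro k
      rw [Finset.mul_sum]
      exact Finset.sum_congr rfl fun i _ => by ring
    simp only [h1]
    rw [Fin.sum_univ_add]
    simp only [himp2, ← hAgen, hinv1]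
    simp [sub_eq_add_neg, mul_comm]
  rw [hdetd]
  simp only [hXGd, mul_add, Finset.sum_add_distrib]
  rw [hmain]
  simp only [fun l : Fin t => hchain (Xt (Fin.natAdd s l)) (hXd _) l, Finset.sum_add_distrib]
  rw [Fin.sum_univ_add (fun i => fderiv ℂ (Xt i) (ψ w) (Pi.single i 1))]
  ring
end

section
/- (Adjunction formula for metric determinants.) In the two-chart setting below, assume moreover that the s×s matrices A_x(x) = (∂Ĝ_i/∂x^j)_{1≤i,j≤s} and A_y(y) = (∂G_i/∂y^j)_{1≤i,j≤s} are invertible at the relevant points. Let h : U' → ℂ^{N×N} be a smooth map whose value h(y) is a positive-definite Hermitian matrix for each y (the matrix of a Hermitian metric in the y-coordinates), and define its pullback in x-coordinates H(x) = Dφ(x)ᵀ · h(φ(x)) · conj(Dφ(x)). Define the restricted metric matrices g₁(w) = Dψ₁(w)ᵀ · H(ψ₁(w)) · conj(Dψ₁(w)) and g₂(v) = Dψ₂(v)ᵀ · h(ψ₂(v)) · conj(Dψ₂(v)), which are (N−s)×(N−s) positive-definite Hermitian matrices. Then at corresponding points x = ψ₁(w) ∈ V₁, y = φ(x) = ψ₂(v):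 det g₁(w) = det g₂(v) · |det Dφ(x)|² · |det A_y(y)|² / |det A_x(x)|². -/
open scoped BigOperators ComplexConjugate Matrix ComplexOrder

theorem adj_linear_aux {m n : Type*} [Fintype m] [Fintype n] [DecidableEq m] [DecidableEq n]
    (J : Matrix (m ⊕ n) (m ⊕ n) ℂ) (F K : Matrix m n ℂ) (A A' : Matrix m m ℂ)
    (B B' : Matrix m n ℂ) (hA : IsUnit A.det)
    (h1 : Matrix.fromCols A B * Matrix.fromRows K (1 : Matrix n n ℂ) = 0)
    (h2 : Matrix.fromCols A B * J = Matrix.fromCols A' B')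
    (h3 : Matrix.fromCols A' B' * Matrix.fromRows F (1 : Matrix n n ℂ) = 0) :
    ∃ M : Matrix n n ℂ, J * Matrix.fromRows F (1 : Matrix n n ℂ) = Matrix.fromRows K (1 : Matrix n n ℂ) * M ∧
      A.det * J.det = A'.det * M.det := by
  obtain ⟨J11, J12, J21, J22, rfl⟩ : ∃ a b c d, J = Matrix.fromBlocks a b c d :=
    ⟨_, _, _, _, (Matrix.fromBlocks_toBlocks J).symm⟩
  rw [Matrix.fromCols_mul_fromRows, Matrix.mul_one] at h1 h3
  rw [Matrix.fromCols_mul_fromBlocks, Matrix.fromCols_ext_iff] at h2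
  obtain ⟨h2a, h2b⟩ := h2
  have hB : B = -(A * K) := by rw [eq_neg_iff_add_eq_zero, add_comm]; exact h1
  have h4 : A * (J11 * F + J12) + B * (J21 * F + J22) = 0 := by
    rw [← h3, ← h2a, ← h2b]
    simp only [Matrix.mul_add, Matrix.add_mul, Matrix.mul_assoc]
    abel
  refine ⟨J21 * F + J22, ?_, ?_⟩
  · rw [Matrix.fromBlocks_mul_fromRows, Matrix.fromRows_mul, Matrix.fromRows_ext_iff]
    simp only [Matrix.mul_one, Matrix.one_mul]
    refine ⟨?_, trivial⟩
    have h5 : A * (J11 * F + J12) = A * (K * (J21 * F + J22)) := by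
      rw [hB, Matrix.neg_mul, add_neg_eq_zero, Matrix.mul_assoc] at h4
      exact h4
    have := congrArg (A⁻¹ * ·) h5
    simpa only [Matrix.nonsing_inv_mul_cancel_left _ _ hA] using this
  · have key : Matrix.fromBlocks A B 0 1 * Matrix.fromBlocks J11 J12 J21 J22 *
        Matrix.fromBlocks 1 F 0 1 = Matrix.fromBlocks A' 0 J21 (J21 * F + J22) := by
      rw [Matrix.fromBlocks_multiply, Matrix.fromBlocks_multiply, Matrix.fromBlocks_inj]
      simp only [Matrix.mul_one, Matrix.mul_zero, add_zero, Matrix.zero_mul, Matrix.one_mul,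
        zero_add]
      refine ⟨h2a, ?_, trivial, trivial⟩
      rw [h2a, h2b]; exact h3
    have := congrArg Matrix.det key
    rw [Matrix.det_mul, Matrix.det_mul, Matrix.det_fromBlocks_zero₂₁,
      Matrix.det_fromBlocks_zero₂₁, Matrix.det_fromBlocks_zero₁₂] at this
    simpa using this

theorem adj_linear {s t : ℕ} (J : Matrix (Fin (s + t)) (Fin (s + t)) ℂ)
    (P Q : Matrix (Fin (s + t)) (Fin t) ℂ) (B B' : Matrix (Fin s) (Fin (s + t)) ℂ)
    (A A' : Matrix (Fin s) (Fin s) ℂ)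
    (hBA : ∀ i j, A i j = B i (Fin.castAdd t j)) (hBA' : ∀ i j, A' i j = B' i (Fin.castAdd t j))
    (hP : ∀ i j, P (Fin.natAdd s i) j = (1 : Matrix (Fin t) (Fin t) ℂ) i j)
    (hQ : ∀ i j, Q (Fin.natAdd s i) j = (1 : Matrix (Fin t) (Fin t) ℂ) i j)
    (hA : IsUnit A.det) (h1 : B * Q = 0) (h2 : B * J = B') (h3 : B' * P = 0) :
    ∃ M : Matrix (Fin t) (Fin t) ℂ, J * P = Q * M ∧ A.det * J.det = A'.det * M.det := by
  let e : Fin s ⊕ Fin t ≃ Fin (s + t) := finSumFinEquiv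
  have eP : P.submatrix e id =
      Matrix.fromRows (Matrix.of fun i j => P (Fin.castAdd t i) j) (1 : Matrix (Fin t) (Fin t) ℂ) := by
    ext i j; rcases i with i | i <;> simp [e, hP]
  have eQ : Q.submatrix e id =
      Matrix.fromRows (Matrix.of fun i j => Q (Fin.castAdd t i) j) (1 : Matrix (Fin t) (Fin t) ℂ) := by
    ext i j; rcases i with i | i <;> simp [e, hQ]
  have eB : B.submatrix id e =
      Matrix.fromCols A (Matrix.of fun i j => B i (Fin.natAdd s j)) := by
    ext i j; rcases j with j | j <;> simp [e, hBA]
  have eB' : B'.submatrix id e =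
      Matrix.fromCols A' (Matrix.of fun i j => B' i (Fin.natAdd s j)) := by
    ext i j; rcases j with j | j <;> simp [e, hBA']
  obtain ⟨M, hM1, hM2⟩ := adj_linear_aux (J.submatrix e e) _ _ A A' _ _ hA
    (by rw [← eB, ← eQ, Matrix.submatrix_mul_equiv, h1]; rfl)
    (by rw [← eB, Matrix.submatrix_mul_equiv, h2]; exact eB')
    (by rw [← eB', ← eP, Matrix.submatrix_mul_equiv, h3]; rfl)
  refine ⟨M, ?_, by simpa using hM2⟩
  rw [← eP, ← eQ, Matrix.submatrix_mul_equiv] at hM1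
  ext i j
  have := congrFun (congrFun hM1 (e.symm i)) j
  simpa [Matrix.mul_apply] using this

theorem adj_chain {n m : ℕ} (F : (Fin n → ℂ) → (Fin m → ℂ)) (g : (Fin m → ℂ) → ℂ)
    (x : Fin n → ℂ) (hF : DifferentiableAt ℂ F x) (hg : DifferentiableAt ℂ g (F x))
    (e : Fin n → ℂ) :
    fderiv ℂ (fun x' => g (F x')) x e =
      ∑ k, fderiv ℂ g (F x) (Pi.single k 1) * fderiv ℂ (fun x' => F x' k) x e := by
  have h1 : fderiv ℂ (fun x' => g (F x')) x = (fderiv ℂ g (F x)).comp (fderiv ℂ F x) :=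
    fderiv_comp x hg hF
  have h2 : ∀ k, fderiv ℂ (fun x' => F x' k) x e = fderiv ℂ F x e k := by
    intro k
    have := (hasFDerivAt_pi'.1 hF.hasFDerivAt k).fderiv
    rw [this]; rfl
  rw [h1]
  simp only [h2, ContinuousLinearMap.comp_apply]
  conv_lhs => rw [pi_eq_sum_univ' (fderiv ℂ F x e)]
  rw [map_sum]
  refine Finset.sum_congr rfl fun k _ => ?_
  rw [map_smul, smul_eq_mul, mul_comm]

theorem adj_param {s t : ℕ} (W : Set (Fin t → ℂ)) (f : Fin s → (Fin t → ℂ) → ℂ)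
    (hf : ∀ j, AnalyticOnNhd ℂ (f j) W) (ψ : (Fin t → ℂ) → (Fin (s + t) → ℂ))
    (hψ : ∀ w, ψ w = Fin.append (fun i => f i w) w) (w : Fin t → ℂ) (hw : w ∈ W) :
    DifferentiableAt ℂ ψ w ∧ ∀ i j, fderiv ℂ (fun w' => ψ w' (Fin.natAdd s i)) w
      (Pi.single j 1) = (1 : Matrix (Fin t) (Fin t) ℂ) i j := by
  constructor
  · rw [differentiableAt_pi]
    intro i
    simp only [hψ]
    refine Fin.addCases (fun i => ?_) (fun i => ?_) i
    · simpa using (hf i w hw).differentiableAt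
    · simp only [Fin.append_right]; fun_prop
  · intro i j
    simp only [hψ, Fin.append_right]
    rw [(hasFDerivAt_apply i w).fderiv]
    simp [Matrix.one_apply, Pi.single_apply]

theorem adj_zero {n : ℕ} (W : Set (Fin n → ℂ)) (hW : IsOpen W) (F : (Fin n → ℂ) → ℂ)
    (hF : ∀ w ∈ W, F w = 0) (w : Fin n → ℂ) (hw : w ∈ W) : fderiv ℂ F w = 0 := by
  have : F =ᶠ[nhds w] fun _ => 0 := by
    filter_upwards [hW.mem_nhds hw] with a ha using hF a ha
  rw [this.fderiv_eq]; simp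

/-- **Proposition 4.1 of the paper (adjunction formula for metric determinants).**

Two-chart setting: `φ : U → U'` is a biholomorphism of open subsets of
`ℂ^N = Fin (s+t) → ℂ`, `G i` are holomorphic on `U'`, `Ĝ i = G i ∘ φ`, and
`V₁ = {Ĝ = 0}` (resp. `φ(V₁) = {G = 0}`) is parametrized by `ψ₁ w = (f w, w)`
(resp. `ψ₂ v = (g v, v)`).  `h` is (the matrix of) a smooth Hermitian metric on `U'`,
`H x = Dφ(x)ᵀ h(φ x) conj(Dφ(x))` its pullback, and
`g₁ w = Dψ₁(w)ᵀ H(ψ₁ w) conj(Dψ₁(w))`, `g₂ v = Dψ₂(v)ᵀ h(ψ₂ v) conj(Dψ₂(v))`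
the restricted metric matrices.  With `A_x = (∂Ĝ_i/∂x^j)_{i,j≤s}`,
`A_y = (∂G_i/∂y^j)_{i,j≤s}` invertible at the relevant points, at corresponding
points `x = ψ₁ w`, `y = φ x = ψ₂ v`:
`det g₁(w) = det g₂(v) |det Dφ(x)|² |det A_y(y)|² / |det A_x(x)|²`. -/
theorem adjunction_formula_metric_determinants
    (s t : ℕ) (hs : 1 ≤ s)
    (U U' : Set (Fin (s + t) → ℂ)) (hU : IsOpen U) (hU' : IsOpen U')
    (φ φinv : (Fin (s + t) → ℂ) → (Fin (s + t) → ℂ))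
    (hφ : AnalyticOnNhd ℂ φ U) (hφinv : AnalyticOnNhd ℂ φinv U')
    (hφmaps : Set.MapsTo φ U U') (hφinvmaps : Set.MapsTo φinv U' U)
    (hleft : ∀ x ∈ U, φinv (φ x) = x) (hright : ∀ y ∈ U', φ (φinv y) = y)
    (G : Fin s → (Fin (s + t) → ℂ) → ℂ)
    (hG : ∀ i, AnalyticOnNhd ℂ (G i) U')
    (W W' : Set (Fin t → ℂ)) (hW : IsOpen W) (hW' : IsOpen W')
    (f g : Fin s → (Fin t → ℂ) → ℂ)
    (hf : ∀ j, AnalyticOnNhd ℂ (f j) W) (hg : ∀ j, AnalyticOnNhd ℂ (g j) W')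
    (ψ₁ ψ₂ : (Fin t → ℂ) → (Fin (s + t) → ℂ))
    (hψ₁ : ∀ w, ψ₁ w = Fin.append (fun i => f i w) w)
    (hψ₂ : ∀ v, ψ₂ v = Fin.append (fun i => g i v) v)
    (hψ₁U : ∀ w ∈ W, ψ₁ w ∈ U)
    (hψ₁V : ∀ w ∈ W, ∀ i, G i (φ (ψ₁ w)) = 0)
    (hψ₂U : ∀ v ∈ W', ψ₂ v ∈ U')
    (hψ₂V : ∀ v ∈ W', ∀ i, G i (ψ₂ v) = 0)
    -- the Hermitian metric `h` on `U'`, as a smooth positive-definite matrix field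
    (h : (Fin (s + t) → ℂ) → Fin (s + t) → Fin (s + t) → ℂ)
    (hsmooth : ContDiff ℝ (⊤ : ℕ∞) h)
    (hpos : ∀ y ∈ U', (Matrix.of (h y)).PosDef)
    -- Jacobian matrices
    (Dφ : (Fin (s + t) → ℂ) → Matrix (Fin (s + t)) (Fin (s + t)) ℂ)
    (hDφ : ∀ x, Dφ x = Matrix.of fun i j =>
      fderiv ℂ (fun x' => φ x' i) x (Pi.single j 1))
    (Dψ₁ : (Fin t → ℂ) → Matrix (Fin (s + t)) (Fin t) ℂ)
    (hDψ₁ : ∀ w, Dψ₁ w = Matrix.of fun i j =>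
      fderiv ℂ (fun w' => ψ₁ w' i) w (Pi.single j 1))
    (Dψ₂ : (Fin t → ℂ) → Matrix (Fin (s + t)) (Fin t) ℂ)
    (hDψ₂ : ∀ v, Dψ₂ v = Matrix.of fun i j =>
      fderiv ℂ (fun v' => ψ₂ v' i) v (Pi.single j 1))
    -- the pullback metric `H` on `U` and the restricted metrics `g₁`, `g₂`
    (H : (Fin (s + t) → ℂ) → Matrix (Fin (s + t)) (Fin (s + t)) ℂ)
    (hH : ∀ x, H x = (Dφ x)ᵀ * Matrix.of (h (φ x)) * (Dφ x).map (starRingEnd ℂ))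
    (g₁ g₂ : (Fin t → ℂ) → Matrix (Fin t) (Fin t) ℂ)
    (hg₁ : ∀ w, g₁ w = (Dψ₁ w)ᵀ * H (ψ₁ w) * (Dψ₁ w).map (starRingEnd ℂ))
    (hg₂ : ∀ v, g₂ v = (Dψ₂ v)ᵀ * Matrix.of (h (ψ₂ v)) * (Dψ₂ v).map (starRingEnd ℂ))
    -- the matrices `A_x`, `A_y`
    (Ax Ay : (Fin (s + t) → ℂ) → Matrix (Fin s) (Fin s) ℂ)
    (hAx : ∀ x, Ax x = Matrix.of fun i j =>
      fderiv ℂ (fun x' => G i (φ x')) x (Pi.single (Fin.castAdd t j) 1))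
    (hAy : ∀ y, Ay y = Matrix.of fun i j =>
      fderiv ℂ (G i) y (Pi.single (Fin.castAdd t j) 1)) :
    ∀ w ∈ W, ∀ v ∈ W', φ (ψ₁ w) = ψ₂ v →
      IsUnit ((Ax (ψ₁ w)).det) → IsUnit ((Ay (ψ₂ v)).det) →
      (g₁ w).det
        = (g₂ v).det * (Complex.normSq (Dφ (ψ₁ w)).det : ℂ)
            * (Complex.normSq (Ay (ψ₂ v)).det : ℂ)
            / (Complex.normSq (Ax (ψ₁ w)).det : ℂ) := by
  intro w hw v hv hwv hAxu hAyu
  obtain ⟨dψ₁, nψ₁⟩ := adj_param W f hf ψ₁ hψ₁ w hw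
  obtain ⟨dψ₂, nψ₂⟩ := adj_param W' g hg ψ₂ hψ₂ v hv
  have dφ : DifferentiableAt ℂ φ (ψ₁ w) := (hφ _ (hψ₁U w hw)).differentiableAt
  have dG : ∀ i, DifferentiableAt ℂ (G i) (ψ₂ v) := fun i =>
    (hG i _ (hψ₂U v hv)).differentiableAt
  have dG' : ∀ i, DifferentiableAt ℂ (G i) (φ (ψ₁ w)) := fun i => by rw [hwv]; exact dG i
  have dGφ : ∀ i, DifferentiableAt ℂ (fun x' => G i (φ x')) (ψ₁ w) := fun i =>
    (dG' i).comp _ dφ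
  obtain ⟨M, hM1, hM2⟩ := adj_linear (Dφ (ψ₁ w)) (Dψ₁ w) (Dψ₂ v)
    (Matrix.of fun i k => fderiv ℂ (G i) (ψ₂ v) (Pi.single k 1))
    (Matrix.of fun i k => fderiv ℂ (fun x' => G i (φ x')) (ψ₁ w) (Pi.single k 1))
    (Ay (ψ₂ v)) (Ax (ψ₁ w)) (fun i j => by rw [hAy]; rfl) (fun i j => by rw [hAx]; rfl)
    (fun i j => by rw [hDψ₁]; exact nψ₁ i j) (fun i j => by rw [hDψ₂]; exact nψ₂ i j) hAyu
    (by
      ext i j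
      rw [hDψ₂, Matrix.mul_apply]
      refine (adj_chain ψ₂ (G i) v dψ₂ (dG i) (Pi.single j 1)).symm.trans ?_
      rw [adj_zero W' hW' _ (fun v hv => hψ₂V v hv i) v hv]; rfl)
    (by
      ext i j
      rw [hDφ, Matrix.mul_apply, ← hwv]
      exact (adj_chain φ (G i) (ψ₁ w) dφ (dG' i) (Pi.single j 1)).symm)
    (by
      ext i j
      rw [hDψ₁, Matrix.mul_apply]
      refine (adj_chain ψ₁ (fun x' => G i (φ x')) w dψ₁ (dGφ i) (Pi.single j 1)).symm.trans ?_
      rw [adj_zero W hW _ (fun v hv => hψ₁V v hv i) w hw]; rfl)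
  have hg12 : g₁ w = Mᵀ * g₂ v * M.map (starRingEnd ℂ) := by
    have e1 := congrArg Matrix.transpose hM1
    have e2 := congrArg (fun X => X.map (starRingEnd ℂ)) hM1
    simp only [Matrix.transpose_mul, Matrix.map_mul] at e1 e2
    calc g₁ w = ((Dψ₁ w)ᵀ * (Dφ (ψ₁ w))ᵀ) * Matrix.of (h (ψ₂ v)) *
          ((Dφ (ψ₁ w)).map (starRingEnd ℂ) * (Dψ₁ w).map (starRingEnd ℂ)) := by
          rw [hg₁, hH, hwv]; simp only [Matrix.mul_assoc]
      _ = _ := by rw [e1, e2, hg₂]; simp only [Matrix.mul_assoc]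
  have hdetc : (M.map (starRingEnd ℂ)).det = (starRingEnd ℂ) M.det :=
    ((starRingEnd ℂ).map_det M).symm
  have hx : (Complex.normSq (Ax (ψ₁ w)).det : ℂ) ≠ 0 := by
    simpa [Complex.normSq_eq_zero] using hAxu.ne_zero
  have hn : (Complex.normSq (Ay (ψ₂ v)).det : ℂ) * (Complex.normSq (Dφ (ψ₁ w)).det : ℂ)
      = (Complex.normSq (Ax (ψ₁ w)).det : ℂ) * (Complex.normSq M.det : ℂ) := by
    rw [← Complex.ofReal_mul, ← Complex.ofReal_mul, ← map_mul, ← map_mul, hM2]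
  rw [eq_div_iff hx, hg12, Matrix.det_mul, Matrix.det_mul, Matrix.det_transpose, hdetc]
  have hm : M.det * (starRingEnd ℂ) M.det = (Complex.normSq M.det : ℂ) := Complex.mul_conj _
  linear_combination (g₂ v).det * (Complex.normSq (Ax (ψ₁ w)).det : ℂ) * hm - (g₂ v).det * hn
end

section
/- In the complete-intersection setting below, the locally defined functions ξ_{αβ₁…β_s} glue to a single global function on M_reg: for any two admissible chart data (α, β₁,…,β_s) and (α', β'₁,…,β'_s), one has ξ_{αβ₁…β_s}(p) = ξ_{α'β'₁…β'_s}(p) for every p ∈ M_reg ∩ U_{αβ₁…β_s} ∩ U_{α'β'₁…β'_s}; moreover this common value is a strictly positive real number at every point, so {ξ_{αβ₁…β_s}} defines a global smooth positive function on M_reg. -/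
open scoped BigOperators ComplexConjugate

lemma aux_det_dual {ι κ : Type*} [Fintype ι] [DecidableEq ι] [Fintype κ] [DecidableEq κ]
    (A : Matrix ι ι ℂ) (B : Matrix ι κ ℂ) (P1 : Matrix ι κ ℂ) (P2 : Matrix κ κ ℂ)
    (h : A * P1 + B * P2 = 0) (hA : IsUnit A.det) (hP : P2.det = 1) :
    (P1.conjTranspose * P1 + P2.conjTranspose * P2).det * (Complex.normSq A.det : ℂ)
      = (A * A.conjTranspose + B * B.conjTranspose).det := by
  set C := A⁻¹ * B with hC
  have hB : B = A * C := by rw [hC, Matrix.mul_nonsing_inv_cancel_left _ _ hA]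
  have hP1 : P1 = -(C * P2) := by
    have h1 : A * P1 = -(B * P2) := eq_neg_of_add_eq_zero_left h
    have h2 : A⁻¹ * (A * P1) = P1 := Matrix.nonsing_inv_mul_cancel_left _ _ hA
    rw [← h2, h1, hC, Matrix.mul_neg, Matrix.mul_assoc]
  have e1 : P1.conjTranspose * P1 + P2.conjTranspose * P2
      = P2.conjTranspose * (1 + C.conjTranspose * C) * P2 := by
    rw [hP1]
    simp only [Matrix.conjTranspose_neg, Matrix.conjTranspose_mul, Matrix.neg_mul, Matrix.mul_neg,
      neg_neg, Matrix.mul_add, Matrix.add_mul, Matrix.mul_one, Matrix.mul_assoc]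
    rw [add_comm]
  have e2 : A * A.conjTranspose + B * B.conjTranspose
      = A * (1 + C * C.conjTranspose) * A.conjTranspose := by
    rw [hB]
    simp only [Matrix.conjTranspose_mul, Matrix.mul_add, Matrix.add_mul, Matrix.mul_one,
      Matrix.mul_assoc]
  rw [e1, e2, Matrix.det_mul, Matrix.det_mul, Matrix.det_mul, Matrix.det_mul,
    Matrix.det_conjTranspose, Matrix.det_conjTranspose, hP, Matrix.det_one_add_mul_comm,
    ← Complex.mul_conj]
  simp only [star_one, one_mul, mul_one]
  simp only [← starRingEnd_apply]
  ring

lemma aux_schur {K n : Type*} [Fintype K] [DecidableEq K] [Fintype n] [DecidableEq n]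
    (x : K → ℂ) (J : Matrix K n ℂ) (q : ℂ) (hq : q = ∑ k, x k * conj (x k)) (hq0 : q ≠ 0)
    (g : Matrix n n ℂ)
    (hg : ∀ i j, g i j = ∑ a, ∑ b, J a i * ((q * (if a = b then 1 else 0) - conj (x a) * x b) / q ^ 2)
      * conj (J b j))
    (P : Matrix K (Unit ⊕ n) ℂ) (hP : P = Matrix.fromCols (Matrix.of fun k (_ : Unit) => x k) J) :
    (P.conjTranspose * P).det = q ^ (Fintype.card n + 1) * g.det := by
  rw [← Matrix.det_transpose]
  set X : Matrix K Unit ℂ := Matrix.of fun k (_ : Unit) => x k with hX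
  have hS : (P.conjTranspose * P).transpose = Matrix.fromBlocks
      (Matrix.diagonal fun _ => q) (J.conjTranspose * X).transpose
      (X.conjTranspose * J).transpose (J.conjTranspose * J).transpose := by
    ext i j
    rcases i with i | i <;> rcases j with j | j <;>
      simp [hP, hX, Matrix.mul_apply, hq, mul_comm]
  rw [hS]
  have : Invertible (Matrix.diagonal fun _ : Unit => q) := by
    apply Matrix.invertibleOfIsUnitDet
    simp [hq0]
  rw [Matrix.det_fromBlocks₁₁, pow_succ', mul_assoc, ← Matrix.det_smul]
  congr 1
  · simp
  · congr 1
    ext i j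
    have hinv : ⅟(Matrix.diagonal fun _ : Unit => q) = Matrix.diagonal fun _ : Unit => q⁻¹ := by
      rw [Matrix.invOf_eq_nonsing_inv]
      apply Matrix.inv_eq_right_inv
      simp [hq0]
    rw [hinv, Matrix.smul_apply, hg]
    have : ∀ a b, J a i * ((q * (if a = b then 1 else 0) - conj (x a) * x b) / q ^ 2) * conj (J b j)
      = q⁻¹ * (if a = b then J a i * conj (J b j) else 0)
        - q⁻¹ * q⁻¹ * ((conj (x a) * J a i) * (x b * conj (J b j))) := by
      intro a b
      split_ifs <;> field_simp
      ring
    simp only [this, Finset.sum_sub_distrib, ← Finset.mul_sum, ← Finset.sum_mul]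
    simp [Matrix.mul_apply, hX, mul_sub]
    rw [← mul_assoc, mul_inv_cancel₀ hq0, ← mul_assoc q, ← mul_assoc q, mul_inv_cancel₀ hq0]
    simp only [mul_comm, one_mul]
    ring_nf

lemma aux_chart {K ι n : Type*} [Fintype K] [DecidableEq K] [Fintype n] [DecidableEq n]
    [Fintype ι] [DecidableEq ι]
    (x : K → ℂ) (J : Matrix K n ℂ) (q : ℂ) (hq : q = ∑ k, x k * conj (x k)) (hq0 : q ≠ 0)
    (g : Matrix n n ℂ)
    (hg : ∀ i j, g i j = ∑ a, ∑ b, J a i * ((q * (if a = b then 1 else 0) - conj (x a) * x b) / q ^ 2)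
      * conj (J b j))
    (G : Matrix ι K ℂ) (α : K) (β : ι → K) (e : n → K)
    (hβ : Function.Injective β) (he : Function.Injective e)
    (hβα : ∀ i, β i ≠ α) (heα : ∀ j, e j ≠ α) (hβe : ∀ i j, β i ≠ e j)
    (hcover : ∀ k, k = α ∨ k ∈ Set.range β ∨ k ∈ Set.range e)
    (hx : x α = 1) (hJα : ∀ j, J α j = 0) (hJe : ∀ i j, J (e i) j = if i = j then 1 else 0)
    (hGx : ∀ i, ∑ k, G i k * x k = 0) (hGJ : ∀ i j, ∑ k, G i k * J k j = 0)
    (A : Matrix ι ι ℂ) (hA : ∀ i j, A i j = G i (β j)) (hAu : IsUnit A.det) :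
    q ^ (Fintype.card n + 1) * g.det * (Complex.normSq A.det : ℂ)
      = (G * G.conjTranspose).det := by
  let f : ι ⊕ (Unit ⊕ n) → K := Sum.elim β (Sum.elim (fun _ => α) e)
  have hf : Function.Bijective f := by
    constructor
    · refine hβ.sumElim (Function.Injective.sumElim (fun _ _ _ => rfl) he ?_) ?_
      · intro _ j; exact (heα j).symm
      · rintro i (_ | j)
        · exact hβα i
        · exact hβe i j
    · intro k
      rcases hcover k with h | ⟨i, h⟩ | ⟨j, h⟩
      · exact ⟨Sum.inr (Sum.inl ()), h.symm⟩
      · exact ⟨Sum.inl i, h⟩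
      · exact ⟨Sum.inr (Sum.inr j), h⟩
  let φ := Equiv.ofBijective f hf
  have hsum : ∀ u : K → ℂ, ∑ k, u k = ∑ i, u (β i) + ∑ j : Unit ⊕ n, u (Sum.elim (fun _ => α) e j) := by
    intro u
    rw [← Equiv.sum_comp φ, Fintype.sum_sum_type]
    rfl
  rw [← aux_schur x J q hq hq0 g hg _ rfl]
  set P : Matrix K (Unit ⊕ n) ℂ := Matrix.fromCols (Matrix.of fun k (_ : Unit) => x k) J with hP
  let B : Matrix ι (Unit ⊕ n) ℂ := Matrix.of fun i j => G i (Sum.elim (fun _ => α) e j)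
  let P1 : Matrix ι (Unit ⊕ n) ℂ := Matrix.of fun i j => P (β i) j
  let P2 : Matrix (Unit ⊕ n) (Unit ⊕ n) ℂ := Matrix.of fun i j => P (Sum.elim (fun _ => α) e i) j
  have h0 : A * P1 + B * P2 = 0 := by
    ext i j
    have : ∑ k, G i k * P k j = 0 := by
      rcases j with j | j
      · simpa [hP] using hGx i
      · simpa [hP] using hGJ i j
    rw [hsum] at this
    simpa [Matrix.mul_apply, hA, P1, B, P2] using this
  have hP2 : P2.det = 1 := by
    have : P2 = Matrix.fromBlocks 1 0 (Matrix.of fun i _ => x (e i)) 1 := by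
      ext i j
      rcases i with i | i <;> rcases j with j | j <;>
        simp [P2, hP, hx, hJα, hJe, Matrix.one_apply]
    rw [this, Matrix.det_fromBlocks_zero₁₂]
    simp
  have := aux_det_dual A B P1 P2 h0 hAu hP2
  convert this using 2
  · congr 1
    ext i j
    simp only [Matrix.mul_apply, Matrix.add_apply]
    rw [hsum]; rfl
  · ext i j
    simp only [Matrix.mul_apply, Matrix.add_apply]
    rw [hsum]
    simp [hA, B]

open scoped ComplexOrder in
lemma aux_pos {K ι : Type*} [Fintype K] [Fintype ι] [DecidableEq ι]
    (G : Matrix ι K ℂ) (β : ι → K) (A : Matrix ι ι ℂ) (hA : ∀ i j, A i j = G i (β j))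
    (hAu : IsUnit A.det) : (G * G.conjTranspose).det.im = 0 ∧
    0 < (G * G.conjTranspose).det.re := by
  suffices h : 0 < (G * G.conjTranspose).det by
    obtain ⟨h1, h2⟩ := Complex.pos_iff.1 h
    exact ⟨h2.symm, h1⟩
  apply Matrix.PosDef.det_pos
  apply Matrix.PosDef.mul_conjTranspose_self
  intro u v huv
  have : Function.Injective A.vecMul := Matrix.vecMul_injective_of_isUnit
    ((Matrix.isUnit_iff_isUnit_det A).2 hAu)
  apply this
  ext j
  have := congrFun huv (β j)
  simpa [Matrix.vecMul, dotProduct, hA] using this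

lemma aux_hom {K : Type*} [Fintype K] (p : MvPolynomial K ℂ) (d : ℕ) (hp : p.IsHomogeneous d)
    (c : ℂ) (x : K → ℂ) :
    MvPolynomial.eval (fun k => c * x k) p = c ^ d * MvPolynomial.eval x p := by
  rw [MvPolynomial.eval_eq', MvPolynomial.eval_eq', Finset.mul_sum]
  refine Finset.sum_congr rfl fun m hm => ?_
  have hd := hp (MvPolynomial.mem_support_iff.1 hm)
  have hd : ∑ i, m i = d := by
    rw [← hd, Finsupp.weight_apply, Finsupp.sum_fintype] <;> simp
  simp only [mul_pow, Finset.prod_mul_distrib, Finset.prod_pow_eq_pow_sum, hd]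
  ring

lemma aux_pderiv_hom {K : Type*} [Fintype K] (p : MvPolynomial K ℂ) (d : ℕ)
    (hp : p.IsHomogeneous d) (c : ℂ) (x : K → ℂ) (k : K) :
    c * MvPolynomial.eval (fun k => c * x k) (MvPolynomial.pderiv k p)
      = c ^ d * MvPolynomial.eval x (MvPolynomial.pderiv k p) := by
  rw [aux_hom _ _ hp.pderiv]
  rcases d with _ | d
  · rw [← MvPolynomial.totalDegree_zero_iff_isHomogeneous,
      MvPolynomial.totalDegree_eq_zero_iff_eq_C] at hp
    rw [hp, MvPolynomial.pderiv_C]; simp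
  · simp only [Nat.add_sub_cancel]; ring

lemma aux_deriv {K E : Type*} [Fintype K] [NormedAddCommGroup E] [NormedSpace ℂ E]
    (z : E → K → ℂ) (w : E) (hz : ∀ k, DifferentiableAt ℂ (fun w' => z w' k) w)
    (p : MvPolynomial K ℂ) :
    HasFDerivAt (fun w' => MvPolynomial.eval (z w') p)
      (∑ k, MvPolynomial.eval (z w) (MvPolynomial.pderiv k p) • fderiv ℂ (fun w' => z w' k) w) w := by
  classical
  induction p using MvPolynomial.induction_on with
  | C a =>
    simp only [MvPolynomial.eval_C, MvPolynomial.pderiv_C, map_zero]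
    refine (hasFDerivAt_const a w).congr_fderiv ?_
    ext u; simp
  | add p q hp hq =>
    simp only [map_add]
    refine (hp.add hq).congr_fderiv ?_
    ext u
    simp [add_mul, Finset.sum_add_distrib]
  | mul_X p i hp =>
    have := hp.mul (hz i).hasFDerivAt
    simp only [map_mul, MvPolynomial.eval_X]
    refine this.congr_fderiv ?_
    ext u
    have h1 : ∀ k, MvPolynomial.eval (z w) (MvPolynomial.pderiv k (p * MvPolynomial.X i))
        = MvPolynomial.eval (z w) (MvPolynomial.pderiv k p) * z w i
          + MvPolynomial.eval (z w) p * (if k = i then 1 else 0) := by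
      intro k
      rw [MvPolynomial.pderiv_mul, MvPolynomial.pderiv_X]
      by_cases h : k = i
      · subst h; simp
      · simp [h]
    simp only [h1]
    simp [add_mul, Finset.sum_add_distrib, Finset.mul_sum]
    rw [add_comm]
    congr 1
    exact Finset.sum_congr rfl fun k _ => by ring

lemma aux_full (N s : ℕ) (hsN : s ≤ N)
    (d : Fin s → ℕ) (F : Fin s → MvPolynomial (Fin (N + 1)) ℂ)
    (hF : ∀ i, (F i).IsHomogeneous (d i))
    (m : ℤ) (hm : m = (N + 1 : ℤ) - ∑ i, (d i : ℤ))
    (α : Fin (N + 1)) (β : Fin s → Fin (N + 1)) (e : Fin (N - s) → Fin (N + 1))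
    (hβ : Function.Injective β) (he : Function.Injective e)
    (hβα : ∀ i, β i ≠ α) (heα : ∀ j, e j ≠ α) (hβe : ∀ i j, β i ≠ e j)
    (hcover : ∀ k : Fin (N + 1), k = α ∨ k ∈ Set.range β ∨ k ∈ Set.range e)
    (W : Set (Fin (N - s) → ℂ)) (hW : IsOpen W)
    (z : (Fin (N - s) → ℂ) → (Fin (N + 1) → ℂ))
    (hz : AnalyticOnNhd ℂ z W)
    (hz1 : ∀ w ∈ W, z w α = 1)
    (hze : ∀ w ∈ W, ∀ j, z w (e j) = w j)
    (hzF : ∀ w ∈ W, ∀ i, MvPolynomial.eval (z w) (F i) = 0)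
    (Q : (Fin (N + 1) → ℂ) → ℝ)
    (hQ : ∀ x, Q x = 1 + ∑ k ∈ Finset.univ.erase α, Complex.normSq (x k))
    (gFS : Fin (N + 1) → Fin (N + 1) → (Fin (N + 1) → ℂ) → ℂ)
    (hgFS : ∀ p q x, gFS p q x =
      ((Q x : ℂ) * (if p = q then 1 else 0) - conj (x p) * x q) / (Q x : ℂ) ^ 2)
    (gmat : (Fin (N - s) → ℂ) → Matrix (Fin (N - s)) (Fin (N - s)) ℂ)
    (hgmat : ∀ w, gmat w = Matrix.of fun i j =>
      ∑ p ∈ Finset.univ.erase α, ∑ q ∈ Finset.univ.erase α,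
        fderiv ℂ (fun w' => z w' p) w (Pi.single i 1) * gFS p q (z w) *
          conj (fderiv ℂ (fun w' => z w' q) w (Pi.single j 1)))
    (A : (Fin (N - s) → ℂ) → Matrix (Fin s) (Fin s) ℂ)
    (hA : ∀ w, A w = Matrix.of fun i j =>
      MvPolynomial.eval (z w) (MvPolynomial.pderiv (β j) (F i)))
    (ξ : (Fin (N - s) → ℂ) → ℂ)
    (hξ : ∀ w, ξ w = (gmat w).det * (Complex.normSq (A w).det : ℂ) *
      ((Q (z w) ^ m : ℝ) : ℂ))
    (w : Fin (N - s) → ℂ) (hw : w ∈ W) (hAu : IsUnit (A w).det)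
    (G : Matrix (Fin s) (Fin (N + 1)) ℂ)
    (hG : G = Matrix.of fun i k => MvPolynomial.eval (z w) (MvPolynomial.pderiv k (F i))) :
    0 < Q (z w) ∧ Q (z w) = ∑ k, Complex.normSq (z w k) ∧ ((G * G.conjTranspose).det.im = 0 ∧
    0 < (G * G.conjTranspose).det.re) ∧
    ξ w = (G * G.conjTranspose).det * ((Q (z w) ^ ((s : ℤ) - ∑ i, (d i : ℤ)) : ℝ) : ℂ) := by
  have hA' : ∀ i j, A w i j = G i (β j) := by intro i j; rw [hA, hG]; rfl
  have hQpos : 0 < Q (z w) := by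
    rw [hQ]
    have : 0 ≤ ∑ k ∈ Finset.univ.erase α, Complex.normSq (z w k) :=
      Finset.sum_nonneg fun _ _ => Complex.normSq_nonneg _
    linarith
  have hQs : Q (z w) = ∑ k, Complex.normSq (z w k) := by
    rw [hQ, ← Finset.add_sum_erase _ _ (Finset.mem_univ α), hz1 w hw]; simp
  refine ⟨hQpos, hQs, aux_pos G β (A w) hA' hAu, ?_⟩
  have hWn : W ∈ nhds w := hW.mem_nhds hw
  have hdiff : ∀ k, DifferentiableAt ℂ (fun w' => z w' k) w := fun k =>
    differentiableAt_pi.1 (hz w hw).differentiableAt k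
  let J : Matrix (Fin (N + 1)) (Fin (N - s)) ℂ :=
    Matrix.of fun k j => fderiv ℂ (fun w' => z w' k) w (Pi.single j 1)
  have hJα : ∀ j, J α j = 0 := by
    intro j
    have : (fun w' => z w' α) =ᶠ[nhds w] fun _ => 1 := by
      filter_upwards [hWn] with u hu using hz1 u hu
    simp [J, this.fderiv_eq]
  have hJe : ∀ i j, J (e i) j = if i = j then 1 else 0 := by
    intro i j
    have : (fun w' => z w' (e i)) =ᶠ[nhds w] fun u => u i := by
      filter_upwards [hWn] with u hu using hze u hu i
    simp only [J, Matrix.of_apply, this.fderiv_eq]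
    rw [(hasFDerivAt_apply i w).fderiv]
    simp [Pi.single_apply]
  have hGx : ∀ i, ∑ k, G i k * z w k = 0 := by
    intro i
    have := congrArg (MvPolynomial.eval (z w)) (hF i).sum_X_mul_pderiv
    simp only [map_sum, map_mul, MvPolynomial.eval_X, map_nsmul, hzF w hw i, smul_zero] at this
    rw [← this, hG]
    exact Finset.sum_congr rfl fun k _ => mul_comm _ _
  have hGJ : ∀ i j, ∑ k, G i k * J k j = 0 := by
    intro i j
    have h1 := aux_deriv z w hdiff (F i)
    have h2 : (fun w' => MvPolynomial.eval (z w') (F i)) =ᶠ[nhds w] fun _ => 0 := by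
      filter_upwards [hWn] with u hu using hzF u hu i
    have h3 := h1.unique ((hasFDerivAt_const (0 : ℂ) w).congr_of_eventuallyEq h2)
    have h4 := congrArg (fun L => L (Pi.single j 1)) h3
    simpa [hG, J] using h4
  have hq0 : (Q (z w) : ℂ) ≠ 0 := by exact_mod_cast hQpos.ne'
  have key := aux_chart (z w) J (Q (z w) : ℂ)
    (by rw [hQs]; push_cast; simp [Complex.mul_conj]) hq0 (gmat w)
    (by
      intro i j
      rw [hgmat, Matrix.of_apply, ← Finset.add_sum_erase _ _ (Finset.mem_univ α)]
      simp only [hJα, zero_mul, Finset.sum_const_zero, zero_add]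
      refine Finset.sum_congr rfl fun a _ => ?_
      rw [← Finset.add_sum_erase _ _ (Finset.mem_univ α)]
      simp only [hJα, map_zero, mul_zero, zero_add, hgFS]
      rfl)
    G α β e hβ he hβα heα hβe hcover (hz1 w hw) hJα hJe hGx hGJ (A w) hA' hAu
  rw [← key, hξ, Fintype.card_fin]
  have : m = ((N - s + 1 : ℕ) : ℤ) + ((s : ℤ) - ∑ i, (d i : ℤ)) := by
    rw [hm]; push_cast [hsN]; ring
  rw [this, zpow_add₀ hQpos.ne', zpow_natCast]
  push_cast
  ring

/-- **Lemma 3.1 of the paper**: the locally defined functions `ξ_{αβ₁…β_s}` glue to a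
single global positive function on `M_reg`.

Complete-intersection setting, in chart form.  `F i` are homogeneous polynomials of
degrees `d i` in the homogeneous coordinates `Z_0, …, Z_N` of `CP^N`, cutting out the
variety `M`, and `m = N + 1 - d₁ - ⋯ - d_s`.  A chart datum for `M_reg` consists of a
chart index `α`, indices `β : Fin s → Fin (N+1)` (the implicit coordinates) and
`e : Fin (N-s) → Fin (N+1)` (the free coordinates), together partitioning
`{0, …, N}`, an open set `W` of free coordinates and a holomorphic (local) 
parametrization `z : W → ℂ^{N+1}` of `M` normalized by `z(w)_α = 1`,
`z(w)_{e j} = w j`, and `F_i(z w) = 0`.  With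
`Q(x) = 1 + Σ_{k ≠ α}|x_k|²` (so `Q(z w) = 1 + ‖z‖²` in affine coordinates),
`g^FS_{pq̄}(x) = (Q(x) δ_{pq} - conj(x_p) x_q)/Q(x)²` the Fubini–Study metric,
`g_{ij̄}(w) = Σ_{p,q ≠ α} (∂z_p/∂w_i) g^FS_{pq̄}(z w) conj(∂z_q/∂w_j)` the restricted
metric matrix, `A(w) = (∂F_i^α/∂z_{β_j})(z w)` and
`ξ(w) = det g(w) · |det A(w)|² · Q(z w)^m`, two admissible chart data give the same
value of `ξ` at a common point `p` of `M_reg` (common point: `z'(v) = z(w)/z(w)_{α'}`),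
and this common value is a strictly positive real number. -/
theorem xi_glues_to_global_positive_function
    (N s : ℕ) (hN : 1 ≤ N) (hs1 : 1 ≤ s) (hsN : s ≤ N)
    (d : Fin s → ℕ) (F : Fin s → MvPolynomial (Fin (N + 1)) ℂ)
    (hF : ∀ i, (F i).IsHomogeneous (d i))
    (m : ℤ) (hm : m = (N + 1 : ℤ) - ∑ i, (d i : ℤ))
    -- first chart datum
    (α : Fin (N + 1)) (β : Fin s → Fin (N + 1)) (e : Fin (N - s) → Fin (N + 1))
    (hβ : Function.Injective β) (he : Function.Injective e)
    (hβα : ∀ i, β i ≠ α) (heα : ∀ j, e j ≠ α) (hβe : ∀ i j, β i ≠ e j)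
    (hcover : ∀ k : Fin (N + 1), k = α ∨ k ∈ Set.range β ∨ k ∈ Set.range e)
    (W : Set (Fin (N - s) → ℂ)) (hW : IsOpen W)
    (z : (Fin (N - s) → ℂ) → (Fin (N + 1) → ℂ))
    (hz : AnalyticOnNhd ℂ z W)
    (hz1 : ∀ w ∈ W, z w α = 1)
    (hze : ∀ w ∈ W, ∀ j, z w (e j) = w j)
    (hzF : ∀ w ∈ W, ∀ i, MvPolynomial.eval (z w) (F i) = 0)
    (Q : (Fin (N + 1) → ℂ) → ℝ)
    (hQ : ∀ x, Q x = 1 + ∑ k ∈ Finset.univ.erase α, Complex.normSq (x k))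
    (gFS : Fin (N + 1) → Fin (N + 1) → (Fin (N + 1) → ℂ) → ℂ)
    (hgFS : ∀ p q x, gFS p q x =
      ((Q x : ℂ) * (if p = q then 1 else 0) - conj (x p) * x q) / (Q x : ℂ) ^ 2)
    (gmat : (Fin (N - s) → ℂ) → Matrix (Fin (N - s)) (Fin (N - s)) ℂ)
    (hgmat : ∀ w, gmat w = Matrix.of fun i j =>
      ∑ p ∈ Finset.univ.erase α, ∑ q ∈ Finset.univ.erase α,
        fderiv ℂ (fun w' => z w' p) w (Pi.single i 1) * gFS p q (z w) *
          conj (fderiv ℂ (fun w' => z w' q) w (Pi.single j 1)))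
    (A : (Fin (N - s) → ℂ) → Matrix (Fin s) (Fin s) ℂ)
    (hA : ∀ w, A w = Matrix.of fun i j =>
      MvPolynomial.eval (z w) (MvPolynomial.pderiv (β j) (F i)))
    (ξ : (Fin (N - s) → ℂ) → ℂ)
    (hξ : ∀ w, ξ w = (gmat w).det * (Complex.normSq (A w).det : ℂ) *
      ((Q (z w) ^ m : ℝ) : ℂ))
    -- second chart datum
    (α' : Fin (N + 1)) (β' : Fin s → Fin (N + 1)) (e' : Fin (N - s) → Fin (N + 1))
    (hβ' : Function.Injective β') (he' : Function.Injective e')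
    (hβα' : ∀ i, β' i ≠ α') (heα' : ∀ j, e' j ≠ α') (hβe' : ∀ i j, β' i ≠ e' j)
    (hcover' : ∀ k : Fin (N + 1), k = α' ∨ k ∈ Set.range β' ∨ k ∈ Set.range e')
    (W' : Set (Fin (N - s) → ℂ)) (hW' : IsOpen W')
    (z' : (Fin (N - s) → ℂ) → (Fin (N + 1) → ℂ))
    (hz' : AnalyticOnNhd ℂ z' W')
    (hz1' : ∀ v ∈ W', z' v α' = 1)
    (hze' : ∀ v ∈ W', ∀ j, z' v (e' j) = v j)
    (hzF' : ∀ v ∈ W', ∀ i, MvPolynomial.eval (z' v) (F i) = 0)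
    (Q' : (Fin (N + 1) → ℂ) → ℝ)
    (hQ' : ∀ x, Q' x = 1 + ∑ k ∈ Finset.univ.erase α', Complex.normSq (x k))
    (gFS' : Fin (N + 1) → Fin (N + 1) → (Fin (N + 1) → ℂ) → ℂ)
    (hgFS' : ∀ p q x, gFS' p q x =
      ((Q' x : ℂ) * (if p = q then 1 else 0) - conj (x p) * x q) / (Q' x : ℂ) ^ 2)
    (gmat' : (Fin (N - s) → ℂ) → Matrix (Fin (N - s)) (Fin (N - s)) ℂ)
    (hgmat' : ∀ v, gmat' v = Matrix.of fun i j =>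
      ∑ p ∈ Finset.univ.erase α', ∑ q ∈ Finset.univ.erase α',
        fderiv ℂ (fun v' => z' v' p) v (Pi.single i 1) * gFS' p q (z' v) *
          conj (fderiv ℂ (fun v' => z' v' q) v (Pi.single j 1)))
    (A' : (Fin (N - s) → ℂ) → Matrix (Fin s) (Fin s) ℂ)
    (hA' : ∀ v, A' v = Matrix.of fun i j =>
      MvPolynomial.eval (z' v) (MvPolynomial.pderiv (β' j) (F i)))
    (ξ' : (Fin (N - s) → ℂ) → ℂ)
    (hξ' : ∀ v, ξ' v = (gmat' v).det * (Complex.normSq (A' v).det : ℂ) *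
      ((Q' (z' v) ^ m : ℝ) : ℂ)) :
    -- at a common point of the two chart domains (admissible on both):
    ∀ w ∈ W, ∀ v ∈ W',
      IsUnit (A w).det → IsUnit (A' v).det →
      z w α' ≠ 0 → (∀ k, z' v k = z w k / z w α') →
      ξ w = ξ' v ∧ (ξ w).im = 0 ∧ 0 < (ξ w).re := by
  intro w hw v hv hAu hAu' hl hk
  obtain ⟨hQ0, hQs, ⟨him, hre⟩, hx⟩ := aux_full N s hsN d F hF m hm α β e hβ he hβα heα hβe hcover
    W hW z hz hz1 hze hzF Q hQ gFS hgFS gmat hgmat A hA ξ hξ w hw hAu _ rfl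
  obtain ⟨hQ0', hQs', -, hx'⟩ := aux_full N s hsN d F hF m hm α' β' e' hβ' he' hβα' heα' hβe'
    hcover' W' hW' z' hz' hz1' hze' hzF' Q' hQ' gFS' hgFS' gmat' hgmat' A' hA' ξ' hξ' v hv hAu' _ rfl
  set G : Matrix (Fin s) (Fin (N + 1)) ℂ :=
    Matrix.of fun i k => MvPolynomial.eval (z w) (MvPolynomial.pderiv k (F i)) with hG
  set G' : Matrix (Fin s) (Fin (N + 1)) ℂ :=
    Matrix.of fun i k => MvPolynomial.eval (z' v) (MvPolynomial.pderiv k (F i)) with hG'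
  have hzz : z w = fun k => z w α' * z' v k := by
    funext k
    rw [hk]
    field_simp
  refine ⟨?_, ?_, ?_⟩
  · set l := z w α' with hl_def
    have hGG : l • G = Matrix.diagonal (fun i => l ^ d i) * G' := by
      ext i k
      rw [Matrix.diagonal_mul, Matrix.smul_apply, hG, hG', Matrix.of_apply, Matrix.of_apply,
        smul_eq_mul, ← aux_pderiv_hom (F i) (d i) (hF i) l (z' v) k, ← hzz]
    have hn0 : (0 : ℝ) < Complex.normSq l := Complex.normSq_pos.2 hl
    have hdet : ((Complex.normSq l ^ s : ℝ) : ℂ) * (G * G.conjTranspose).det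
        = ((Complex.normSq l ^ (∑ i, d i) : ℝ) : ℂ) * (G' * G'.conjTranspose).det := by
      have h1 : (l • G) * (l • G).conjTranspose
          = (Complex.normSq l : ℂ) • (G * G.conjTranspose) := by
        rw [Matrix.conjTranspose_smul, Matrix.smul_mul, Matrix.mul_smul, smul_smul,
          ← Complex.mul_conj]
        rfl
      have h2 : (l • G) * (l • G).conjTranspose = Matrix.diagonal (fun i => l ^ d i) *
          (G' * G'.conjTranspose) * (Matrix.diagonal (fun i => l ^ d i)).conjTranspose := by
        rw [hGG, Matrix.conjTranspose_mul]
        simp only [Matrix.mul_assoc]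
      have h3 := congrArg Matrix.det (h1.symm.trans h2)
      rw [Matrix.det_smul, Fintype.card_fin, Matrix.det_mul, Matrix.det_mul,
        Matrix.det_conjTranspose, Matrix.det_diagonal, Finset.prod_pow_eq_pow_sum] at h3
      push_cast
      rw [h3, ← Complex.mul_conj, mul_pow, ← map_pow, starRingEnd_apply]
      ring
    have hQQ : Q (z w) = Complex.normSq l * Q' (z' v) := by
      rw [hQs, hQs', Finset.mul_sum]
      refine Finset.sum_congr rfl fun k _ => ?_
      rw [← Complex.normSq_mul, ← congrFun hzz k]
    have hsum : ∑ i, (d i : ℤ) = ((∑ i, d i : ℕ) : ℤ) := by push_cast; rfl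
    rw [hx, hx', hQQ, mul_zpow, hsum, zpow_sub₀ hn0.ne', zpow_natCast, zpow_natCast]
    have hn1 : ((Complex.normSq l ^ (∑ i, d i) : ℝ) : ℂ) ≠ 0 := by
      exact_mod_cast (pow_pos hn0 _).ne'
    rw [Complex.ofReal_mul, Complex.ofReal_div, ← mul_assoc, mul_div_assoc', mul_comm _ ((Complex.normSq l ^ s : ℝ) : ℂ),
      hdet, mul_div_assoc, mul_comm, mul_div_assoc', mul_div_cancel_left₀ _ hn1, mul_comm]
  · rw [hx, Complex.im_mul_ofReal, him, zero_mul]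
  · rw [hx, Complex.re_mul_ofReal]
    exact mul_pos hre (zpow_pos hQ0 _)
end

section
/- (Explicit Ricci potential of a Fano complete intersection.) In the complete-intersection setting below, define f = −log ξ_{αβ₁…β_s} on M_reg ∩ U_{αβ₁…β_s}. Then in the local coordinates w on M, for all indices i, j: ∂²f/∂w^i∂conj(w^j) = −∂²(log det g_{αβ₁…β_s})/∂w^i∂conj(w^j) − m · ∂²(log(1+Σ_{k≠α}|z_k^α(w)|²))/∂w^i∂conj(w^j). Equivalently, (√−1/2π)∂∂̄f = Ric(ω) − ω on M_reg, where ω = m·ω_FS|_M is the restriction of m times the Fubini–Study form and Ric(ω) = −(√−1/2π)∂∂̄ log det(g) is the Ricci form of the restricted metric. -/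
open scoped BigOperators ComplexConjugate

/-- The Wirtinger holomorphic derivative `∂f/∂z_i`. -/
noncomputable def wirtingerDeriv {ι : Type*} [Fintype ι] [DecidableEq ι]
    (f : (ι → ℂ) → ℂ) (z : ι → ℂ) (i : ι) : ℂ :=
  (1 / 2) * (fderiv ℝ f z (Pi.single i 1) - Complex.I * fderiv ℝ f z (Pi.single i Complex.I))

/-- The Wirtinger antiholomorphic derivative `∂f/∂conj(z_i)`. -/
noncomputable def wirtingerBarDeriv {ι : Type*} [Fintype ι] [DecidableEq ι]
    (f : (ι → ℂ) → ℂ) (z : ι → ℂ) (i : ι) : ℂ :=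
  (1 / 2) * (fderiv ℝ f z (Pi.single i 1) + Complex.I * fderiv ℝ f z (Pi.single i Complex.I))

/-- The operator `∂²/∂w^i∂conj(w^j)`. -/
noncomputable def ddbarAux {ι : Type*} [Fintype ι] [DecidableEq ι]
    (u : (ι → ℂ) → ℂ) (w : ι → ℂ) (i j : ι) : ℂ :=
  wirtingerBarDeriv (fun w' => wirtingerDeriv u w' i) w j

lemma wirtingerDeriv_congr_aux {ι : Type*} [Fintype ι] [DecidableEq ι]
    {u v : (ι → ℂ) → ℂ} {w : ι → ℂ} (h : u =ᶠ[nhds w] v) (i : ι) :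
    wirtingerDeriv u w i = wirtingerDeriv v w i := by
  unfold wirtingerDeriv; rw [h.fderiv_eq]

lemma wirtingerBarDeriv_congr_aux {ι : Type*} [Fintype ι] [DecidableEq ι]
    {u v : (ι → ℂ) → ℂ} {w : ι → ℂ} (h : u =ᶠ[nhds w] v) (i : ι) :
    wirtingerBarDeriv u w i = wirtingerBarDeriv v w i := by
  unfold wirtingerBarDeriv; rw [h.fderiv_eq]

lemma ddbarAux_congr {ι : Type*} [Fintype ι] [DecidableEq ι]
    {u v : (ι → ℂ) → ℂ} {w : ι → ℂ} (h : u =ᶠ[nhds w] v) (i j : ι) :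
    ddbarAux u w i j = ddbarAux v w i j := by
  unfold ddbarAux
  apply wirtingerBarDeriv_congr_aux
  filter_upwards [h.eventually_nhds] with x hx
  exact wirtingerDeriv_congr_aux hx i

lemma wirtingerDeriv_lin_aux {ι : Type*} [Fintype ι] [DecidableEq ι]
    {u v : (ι → ℂ) → ℂ} {w : ι → ℂ} (hu : DifferentiableAt ℝ u w)
    (hv : DifferentiableAt ℝ v w) (a b : ℂ) (i : ι) :
    wirtingerDeriv (fun x => a * u x + b * v x) w i
      = a * wirtingerDeriv u w i + b * wirtingerDeriv v w i := by
  unfold wirtingerDeriv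
  have hd : fderiv ℝ (fun x => a * u x + b * v x) w = a • fderiv ℝ u w + b • fderiv ℝ v w :=
    ((hu.hasFDerivAt.const_mul a).add (hv.hasFDerivAt.const_mul b)).fderiv
  rw [hd]
  simp only [ContinuousLinearMap.add_apply, ContinuousLinearMap.smul_apply, smul_eq_mul]
  ring

lemma wirtingerBarDeriv_lin_aux {ι : Type*} [Fintype ι] [DecidableEq ι]
    {u v : (ι → ℂ) → ℂ} {w : ι → ℂ} (hu : DifferentiableAt ℝ u w)
    (hv : DifferentiableAt ℝ v w) (a b : ℂ) (i : ι) :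
    wirtingerBarDeriv (fun x => a * u x + b * v x) w i
      = a * wirtingerBarDeriv u w i + b * wirtingerBarDeriv v w i := by
  unfold wirtingerBarDeriv
  have hd : fderiv ℝ (fun x => a * u x + b * v x) w = a • fderiv ℝ u w + b • fderiv ℝ v w :=
    ((hu.hasFDerivAt.const_mul a).add (hv.hasFDerivAt.const_mul b)).fderiv
  rw [hd]
  simp only [ContinuousLinearMap.add_apply, ContinuousLinearMap.smul_apply, smul_eq_mul]
  ring

lemma wirtingerDeriv_differentiableAt_aux {ι : Type*} [Fintype ι] [DecidableEq ι]
    {u : (ι → ℂ) → ℂ} {w : ι → ℂ} (hu : ContDiffAt ℝ 2 u w) (i : ι) :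
    DifferentiableAt ℝ (fun x => wirtingerDeriv u x i) w := by
  have h1 : DifferentiableAt ℝ (fderiv ℝ u) w :=
    (hu.fderiv_right (m := 1) (by norm_num)).differentiableAt (by norm_num)
  unfold wirtingerDeriv
  fun_prop

lemma ddbarAux_lin {ι : Type*} [Fintype ι] [DecidableEq ι]
    {u v : (ι → ℂ) → ℂ} {w : ι → ℂ} (hu : ContDiffAt ℝ 2 u w)
    (hv : ContDiffAt ℝ 2 v w) (a b : ℂ) (i j : ι) :
    ddbarAux (fun x => a * u x + b * v x) w i j
      = a * ddbarAux u w i j + b * ddbarAux v w i j := by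
  unfold ddbarAux
  rw [← wirtingerBarDeriv_lin_aux (wirtingerDeriv_differentiableAt_aux hu i)
    (wirtingerDeriv_differentiableAt_aux hv i)]
  apply wirtingerBarDeriv_congr_aux
  filter_upwards [hu.eventually (by simp), hv.eventually (by simp)] with x hx hy
  exact wirtingerDeriv_lin_aux (hx.differentiableAt (by norm_num))
    (hy.differentiableAt (by norm_num)) a b i

lemma wirtingerBarDeriv_holo_aux {ι : Type*} [Fintype ι] [DecidableEq ι]
    {u : (ι → ℂ) → ℂ} {w : ι → ℂ} (hu : DifferentiableAt ℂ u w) (i : ι) :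
    wirtingerBarDeriv u w i = 0 := by
  unfold wirtingerBarDeriv
  rw [(hu.hasFDerivAt.restrictScalars ℝ).fderiv]
  have : (Pi.single i Complex.I : ι → ℂ) = Complex.I • Pi.single i 1 := by
    rw [← Pi.single_smul]; simp
  simp only [ContinuousLinearMap.coe_restrictScalars']
  rw [this, map_smul, smul_eq_mul, ← mul_assoc, Complex.I_mul_I]
  ring

lemma wirtingerDeriv_log_normSq_aux {ι : Type*} [Fintype ι] [DecidableEq ι]
    {h : (ι → ℂ) → ℂ} {w : ι → ℂ} (hh : DifferentiableAt ℂ h w) (h0 : h w ≠ 0) (i : ι) :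
    wirtingerDeriv (fun x => ((Real.log (Complex.normSq (h x)) : ℝ) : ℂ)) w i
      = fderiv ℂ h w (Pi.single i 1) / h w := by
  have h1 : HasFDerivAt h ((fderiv ℂ h w).restrictScalars ℝ) w :=
    hh.hasFDerivAt.restrictScalars ℝ
  have hre := (Complex.reCLM.hasFDerivAt (x := h w)).comp w h1
  have him := (Complex.imCLM.hasFDerivAt (x := h w)).comp w h1
  have hn : Complex.normSq (h w) ≠ 0 := by simpa using h0
  have hlog := ((hre.mul hre).add (him.mul him)).log
    (by simpa [Complex.normSq_apply] using hn)
  have hfin := (Complex.ofRealCLM.hasFDerivAt).comp w hlog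
  have hS : (Pi.single i Complex.I : ι → ℂ) = Complex.I • Pi.single i 1 := by
    rw [← Pi.single_smul]; simp
  unfold wirtingerDeriv
  have hE : (fun x => ((Real.log (Complex.normSq (h x)) : ℝ) : ℂ)) = 
     (⇑Complex.ofRealCLM ∘ fun x => Real.log (((⇑Complex.reCLM ∘ h) * (⇑Complex.reCLM ∘ h)
        + (⇑Complex.imCLM ∘ h) * (⇑Complex.imCLM ∘ h)) x)) := by
    funext x; simp [Complex.normSq_apply]
  rw [hE]
  erw [hfin.fderiv]
  have hn' : (h w).re * (h w).re + (h w).im * (h w).im ≠ 0 := by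
    simpa [Complex.normSq_apply] using hn
  simp [hS]
  generalize fderiv ℂ h w (Pi.single i 1) = c
  rw [eq_div_iff h0]
  have hn2 : (((h w).re : ℂ) ^ 2 + ((h w).im : ℂ) ^ 2) ≠ 0 := by
    rw [pow_two, pow_two]; exact_mod_cast hn'
  field_simp
  generalize h w = q at *
  apply Complex.ext <;> simp [pow_two] <;> ring

lemma log_normSq_contDiffAt_aux {ι : Type*} [Fintype ι]
    {h : (ι → ℂ) → ℂ} {w : ι → ℂ} (hh : ContDiffAt ℝ 2 h w) (h0 : h w ≠ 0) :
    ContDiffAt ℝ 2 (fun x => ((Real.log (Complex.normSq (h x)) : ℝ) : ℂ)) w := by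
  have hn : Complex.normSq (h w) ≠ 0 := by simpa using h0
  have hre := Complex.reCLM.contDiff.contDiffAt.comp (n := 2) w hh
  have him := Complex.imCLM.contDiff.contDiffAt.comp (n := 2) w hh
  have := ((hre.mul hre).add (him.mul him)).log (by simpa [Complex.normSq_apply] using hn)
  refine (Complex.ofRealCLM.contDiff.contDiffAt.comp (n := 2) w this).congr_of_eventuallyEq ?_
  filter_upwards with x
  simp [Complex.normSq_apply]

lemma ddbarAux_log_normSq {ι : Type*} [Fintype ι] [DecidableEq ι]
    {h : (ι → ℂ) → ℂ} {w : ι → ℂ} (hh : AnalyticAt ℂ h w) (h0 : h w ≠ 0) (i j : ι) :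
    ddbarAux (fun x => ((Real.log (Complex.normSq (h x)) : ℝ) : ℂ)) w i j = 0 := by
  have hev : (fun x => wirtingerDeriv
      (fun x => ((Real.log (Complex.normSq (h x)) : ℝ) : ℂ)) x i)
      =ᶠ[nhds w] fun x => fderiv ℂ h x (Pi.single i 1) / h x := by
    filter_upwards [hh.eventually_analyticAt, hh.continuousAt.eventually_ne h0] with x hx hx0
    exact wirtingerDeriv_log_normSq_aux hx.differentiableAt hx0 i
  unfold ddbarAux
  rw [wirtingerBarDeriv_congr_aux hev]
  apply wirtingerBarDeriv_holo_aux
  have := hh.fderiv.differentiableAt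
  have := hh.differentiableAt
  fun_prop (disch := assumption)

lemma det_contDiffAt_aux {E : Type*} [NormedAddCommGroup E] [NormedSpace ℝ E] {n : ℕ}
    {G : E → Matrix (Fin n) (Fin n) ℂ} {w : E}
    (h : ∀ i j, ContDiffAt ℝ 2 (fun x => G x i j) w) :
    ContDiffAt ℝ 2 (fun x => (G x).det) w := by
  simp only [Matrix.det_apply']
  exact ContDiffAt.sum fun σ _ => contDiffAt_const.mul (contDiffAt_prod fun i _ => h _ _)

lemma det_analyticAt_aux {E : Type*} [NormedAddCommGroup E] [NormedSpace ℂ E] {n : ℕ}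
    {G : E → Matrix (Fin n) (Fin n) ℂ} {w : E}
    (h : ∀ i j, AnalyticAt ℂ (fun x => G x i j) w) :
    AnalyticAt ℂ (fun x => (G x).det) w := by
  simp only [Matrix.det_apply']
  exact Finset.analyticAt_fun_sum _ fun σ _ =>
    analyticAt_const.mul (Finset.analyticAt_fun_prod _ fun i _ => h _ _)

/-- **Theorem 3.2 of the paper (explicit Ricci potential of a Fano complete
intersection)**, in chart form.

Complete-intersection setting as in Lemma 3.1: `F i` homogeneous of degree `d i`
cut out `M ⊂ CP^N`, `m = N + 1 - Σ d_i`; in the chart datum `(α, β, e)` the variety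
is parametrized over the open set `W` by the holomorphic `z` with `z(w)_α = 1`,
`z(w)_{e j} = w j`, `F_i(z w) = 0`; `Q(z w) = 1 + ‖z‖²`, `g(w)` is the restricted
Fubini–Study metric matrix, `A(w) = (∂F_i^α/∂z_{β_j})(z w)`, 
`ξ(w) = det g(w)·|det A(w)|²·Q(z w)^m` and `f = -log ξ`.  Then for all `i, j`:
`∂²f/∂w^i∂conj(w^j) = -∂²(log det g)/∂w^i∂conj(w^j) - m·∂²(log Q(z w))/∂w^i∂conj(w^j)`,
i.e. `(√-1/2π)∂∂̄f = Ric(ω) - ω` with `ω = m·ω_FS|_M`. -/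
theorem ricci_potential_of_complete_intersection
    (N s : ℕ) (hN : 1 ≤ N) (hs1 : 1 ≤ s) (hsN : s ≤ N)
    (d : Fin s → ℕ) (F : Fin s → MvPolynomial (Fin (N + 1)) ℂ)
    (hF : ∀ i, (F i).IsHomogeneous (d i))
    (m : ℤ) (hm : m = (N + 1 : ℤ) - ∑ i, (d i : ℤ))
    (α : Fin (N + 1)) (β : Fin s → Fin (N + 1)) (e : Fin (N - s) → Fin (N + 1))
    (hβ : Function.Injective β) (he : Function.Injective e)
    (hβα : ∀ i, β i ≠ α) (heα : ∀ j, e j ≠ α) (hβe : ∀ i j, β i ≠ e j)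
    (hcover : ∀ k : Fin (N + 1), k = α ∨ k ∈ Set.range β ∨ k ∈ Set.range e)
    (W : Set (Fin (N - s) → ℂ)) (hW : IsOpen W)
    (z : (Fin (N - s) → ℂ) → (Fin (N + 1) → ℂ))
    (hz : AnalyticOnNhd ℂ z W)
    (hz1 : ∀ w ∈ W, z w α = 1)
    (hze : ∀ w ∈ W, ∀ j, z w (e j) = w j)
    (hzF : ∀ w ∈ W, ∀ i, MvPolynomial.eval (z w) (F i) = 0)
    (Q : (Fin (N + 1) → ℂ) → ℝ)
    (hQ : ∀ x, Q x = 1 + ∑ k ∈ Finset.univ.erase α, Complex.normSq (x k))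
    (gFS : Fin (N + 1) → Fin (N + 1) → (Fin (N + 1) → ℂ) → ℂ)
    (hgFS : ∀ p q x, gFS p q x =
      ((Q x : ℂ) * (if p = q then 1 else 0) - conj (x p) * x q) / (Q x : ℂ) ^ 2)
    (gmat : (Fin (N - s) → ℂ) → Matrix (Fin (N - s)) (Fin (N - s)) ℂ)
    (hgmat : ∀ w, gmat w = Matrix.of fun i j =>
      ∑ p ∈ Finset.univ.erase α, ∑ q ∈ Finset.univ.erase α,
        fderiv ℂ (fun w' => z w' p) w (Pi.single i 1) * gFS p q (z w) *
          conj (fderiv ℂ (fun w' => z w' q) w (Pi.single j 1)))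
    (A : (Fin (N - s) → ℂ) → Matrix (Fin s) (Fin s) ℂ)
    (hA : ∀ w, A w = Matrix.of fun i j =>
      MvPolynomial.eval (z w) (MvPolynomial.pderiv (β j) (F i)))
    -- admissibility and positivity of the restricted metric on the chart
    (hAunit : ∀ w ∈ W, IsUnit (A w).det)
    (hgpos : ∀ w ∈ W, 0 < ((gmat w).det).re)
    -- the Ricci potential `f = -log ξ`
    (f : (Fin (N - s) → ℂ) → ℝ)
    (hf : ∀ w, f w = -Real.log
      (((gmat w).det).re * Complex.normSq ((A w).det) * Q (z w) ^ m)) :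
    ∀ w ∈ W, ∀ i j : Fin (N - s),
      wirtingerBarDeriv (fun w' => wirtingerDeriv (fun w'' => ((f w'' : ℝ) : ℂ)) w' i) w j
        = - wirtingerBarDeriv (fun w' =>
              wirtingerDeriv (fun w'' => ((Real.log (((gmat w'').det).re) : ℝ) : ℂ)) w' i) w j
          - (m : ℂ) * wirtingerBarDeriv (fun w' =>
              wirtingerDeriv (fun w'' => ((Real.log (Q (z w'')) : ℝ) : ℂ)) w' i) w j := by
  intro w hw i j
  have hzc : ∀ k, AnalyticAt ℂ (fun x => z x k) w := fun k => by
    have := hz w hw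
    exact analyticAt_pi_iff.1 this k
  have hzr : ∀ k, ContDiffAt ℝ 2 (fun x => z x k) w := fun k =>
    (hzc k).contDiffAt.restrict_scalars ℝ
  have hdzr : ∀ k l, ContDiffAt ℝ 2 (fun x => fderiv ℂ (fun w' => z w' k) x (Pi.single l 1)) w :=
    fun k l => by
      have h1 : ContDiffAt ℂ 2 (fun x => fderiv ℂ (fun w' => z w' k) x) w :=
        (hzc k).fderiv.contDiffAt
      exact (h1.clm_apply contDiffAt_const).restrict_scalars ℝ
  have hconj : ∀ {u : (Fin (N - s) → ℂ) → ℂ}, ContDiffAt ℝ 2 u w →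
      ContDiffAt ℝ 2 (fun x => conj (u x)) w := fun hu =>
    (Complex.conjCLE.contDiff.contDiffAt).comp (n := 2) w hu
  have hof : ∀ {u : (Fin (N - s) → ℂ) → ℝ}, ContDiffAt ℝ 2 u w →
      ContDiffAt ℝ 2 (fun x => ((u x : ℝ) : ℂ)) w := fun hu =>
    (Complex.ofRealCLM.contDiff.contDiffAt).comp (n := 2) w hu
  have hrec : ∀ {u : (Fin (N - s) → ℂ) → ℂ}, ContDiffAt ℝ 2 u w →
      ContDiffAt ℝ 2 (fun x => (u x).re) w := fun hu =>
    (Complex.reCLM.contDiff.contDiffAt).comp (n := 2) w hu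
  have himc : ∀ {u : (Fin (N - s) → ℂ) → ℂ}, ContDiffAt ℝ 2 u w →
      ContDiffAt ℝ 2 (fun x => (u x).im) w := fun hu =>
    (Complex.imCLM.contDiff.contDiffAt).comp (n := 2) w hu
  have hQpos : ∀ x, 0 < Q x := fun x => by
    rw [hQ]
    have : 0 ≤ ∑ k ∈ Finset.univ.erase α, Complex.normSq (x k) :=
      Finset.sum_nonneg fun k _ => Complex.normSq_nonneg _
    linarith
  have hQs : ContDiffAt ℝ 2 (fun x => Q (z x)) w := by
    simp only [hQ, Complex.normSq_apply]
    exact contDiffAt_const.add (ContDiffAt.sum fun k _ =>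
      ((hrec (hzr k)).mul (hrec (hzr k))).add ((himc (hzr k)).mul (himc (hzr k))))
  have hgs : ContDiffAt ℝ 2 (fun x => (gmat x).det) w := by
    apply det_contDiffAt_aux
    intro a b
    simp only [hgmat, Matrix.of_apply]
    refine ContDiffAt.sum fun p _ => ContDiffAt.sum fun q _ =>
      ((hdzr p a).mul ?_).mul (hconj (hdzr q b))
    simp only [hgFS, div_eq_mul_inv]
    refine (((hof hQs).mul contDiffAt_const).sub ((hconj (hzr p)).mul (hzr q))).mul
      (((hof hQs).pow 2).inv ?_)
    exact pow_ne_zero _ (by exact_mod_cast (hQpos _).ne')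
  have hAs : AnalyticAt ℂ (fun x => (A x).det) w := by
    apply det_analyticAt_aux
    intro a b
    simp only [hA, Matrix.of_apply]
    exact AnalyticAt.aeval_mvPolynomial (fun k => hzc k) _
  have hA0 : (A w).det ≠ 0 := (hAunit w hw).ne_zero
  have hL1 : ContDiffAt ℝ 2 (fun x => ((Real.log (((gmat x).det).re) : ℝ) : ℂ)) w :=
    hof ((hrec hgs).log (hgpos w hw).ne')
  have hL2 : ContDiffAt ℝ 2 (fun x => ((Real.log (Complex.normSq ((A x).det)) : ℝ) : ℂ)) w :=
    log_normSq_contDiffAt_aux (hAs.contDiffAt.restrict_scalars ℝ) hA0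
  have hL3 : ContDiffAt ℝ 2 (fun x => ((Real.log (Q (z x)) : ℝ) : ℂ)) w :=
    hof (hQs.log (hQpos _).ne')
  have hev : (fun x => ((f x : ℝ) : ℂ)) =ᶠ[nhds w] fun x =>
      1 * ((-1) * ((Real.log (((gmat x).det).re) : ℝ) : ℂ)
        + (-1) * ((Real.log (Complex.normSq ((A x).det)) : ℝ) : ℂ))
      + (-(m : ℂ)) * ((Real.log (Q (z x)) : ℝ) : ℂ) := by
    filter_upwards [hW.mem_nhds hw] with x hx
    have hAx : Complex.normSq (A x).det ≠ 0 := by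
      simpa using (hAunit x hx).ne_zero
    rw [hf, Real.log_mul (mul_ne_zero (hgpos x hx).ne' hAx) (zpow_ne_zero _ (hQpos _).ne'),
      Real.log_mul (hgpos x hx).ne' hAx, Real.log_zpow]
    push_cast
    ring
  change ddbarAux _ w i j = - ddbarAux _ w i j - (m : ℂ) * ddbarAux _ w i j
  rw [ddbarAux_congr hev,
    ddbarAux_lin ((contDiffAt_const.mul hL1).add (contDiffAt_const.mul hL2)) hL3,
    ddbarAux_lin hL1 hL2, ddbarAux_log_normSq hAs hA0]
  ring
end

section
/- (Trace identity for the divergence.) In the complete-intersection setting below, let a = (a_{ij})_{0≤i,j≤N} be a traceless complex matrix determining the holomorphic vector field X = Σ_{i,j=0}^N a_{ij} Z_i ∂/∂Z_j on CP^N, assume X is tangent to M (the flow of the real part of X preserves M), and assume there is a complex s×s matrix c = (c_{ij}) with X F_i = Σ_{j=1}^s c_{ij} F_j for all i; let κ = trace(c). Define on M_reg ∩ U_{αβ₁…β_s}, in the local coordinates w: div X = Σ_i ∂X^i/∂w^i + Σ_i X^i ∂(log det g_{αβ₁…β_s})/∂w^i, where X = Σ_i X^i ∂/∂w^i is the restriction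 of X to M in the coordinates w; f = −log ξ_{αβ₁…β_s}; and θ(z) = −(Σ_{i,j=0}^N a_{ij} ẑ_i conj(ẑ_j))/(Σ_{k=0}^N |ẑ_k|²), where ẑ is the homogeneous representative with ẑ_α = 1, ẑ_j = z_j^α. Then on all of M_reg: div X + X(f) − m·θ = −κ. -/
open scoped BigOperators ComplexConjugate

namespace TraceAux

lemma pderiv_pderiv_comm {σ : Type*} (i j : σ) (p : MvPolynomial σ ℂ) :
    MvPolynomial.pderiv i (MvPolynomial.pderiv j p)
      = MvPolynomial.pderiv j (MvPolynomial.pderiv i p) := by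
  classical
  have h : ⁅(MvPolynomial.pderiv i : Derivation ℂ (MvPolynomial σ ℂ) (MvPolynomial σ ℂ)),
      (MvPolynomial.pderiv j : Derivation ℂ (MvPolynomial σ ℂ) (MvPolynomial σ ℂ))⁆ = 0 := by
    apply MvPolynomial.derivation_ext
    intro k
    simp only [Derivation.commutator_apply, MvPolynomial.pderiv_X, Pi.single_apply]
    split_ifs <;> simp
  have h2 := congrArg (fun D => D p) h
  simp only [Derivation.commutator_apply, Derivation.coe_zero, Pi.zero_apply] at h2
  exact sub_eq_zero.mp h2

/-- Chain rule for polynomials. -/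
lemma hasFDerivAt_eval {E : Type*} [NormedAddCommGroup E] [NormedSpace ℂ E]
    {n : ℕ} (z : E → Fin n → ℂ) (z' : Fin n → E →L[ℂ] ℂ) (w : E)
    (hz : ∀ k, HasFDerivAt (fun w' => z w' k) (z' k) w) (p : MvPolynomial (Fin n) ℂ) :
    HasFDerivAt (fun w' => MvPolynomial.eval (z w') p)
      (∑ k, MvPolynomial.eval (z w) (MvPolynomial.pderiv k p) • z' k) w := by
  induction p using MvPolynomial.induction_on with
  | C a =>
    simp only [MvPolynomial.eval_C]
    refine (hasFDerivAt_const (𝕜 := ℂ) a w).congr_fderiv ?_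
    ext v
    simp
  | add p q hp hq =>
    simp only [map_add]
    refine (hp.fun_add hq).congr_fderiv ?_
    rw [← Finset.sum_add_distrib]
    exact Finset.sum_congr rfl fun k _ => (add_smul _ _ _).symm
  | mul_X p k hp =>
    simp only [map_mul, MvPolynomial.eval_X]
    refine (hp.mul (hz k)).congr_fderiv ?_
    ext v
    have h : ∀ l, MvPolynomial.eval (z w) (MvPolynomial.pderiv l (p * MvPolynomial.X k))
        = MvPolynomial.eval (z w) (MvPolynomial.pderiv l p) * z w k
          + (if l = k then MvPolynomial.eval (z w) p else 0) := by
      intro l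
      simp only [MvPolynomial.pderiv_mul, MvPolynomial.pderiv_X, map_add, map_mul,
        MvPolynomial.eval_X, Pi.single_apply]
      by_cases hl : l = k
      · subst hl; simp
      · simp [hl, Ne.symm hl]
    simp only [h, add_apply, smul_apply, sum_apply, smul_eq_mul, add_mul,
      Finset.sum_add_distrib, ite_mul, zero_mul, Finset.sum_ite_eq', Finset.mem_univ, if_true,
      Finset.mul_sum]
    rw [add_comm]
    congr 1
    exact Finset.sum_congr rfl fun l _ => by ring

lemma det_hasFDerivAt {E : Type*} [NormedAddCommGroup E] [NormedSpace ℂ E]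
    {n : ℕ} (M : E → Matrix (Fin n) (Fin n) ℂ) (M' : Fin n → Fin n → E →L[ℂ] ℂ) (w : E)
    (hM : ∀ i j, HasFDerivAt (fun w' => M w' i j) (M' i j) w) :
    ∃ L : E →L[ℂ] ℂ, HasFDerivAt (fun w' => (M w').det) L w ∧
      ∀ v, L v = ∑ i, ∑ j, (M w).adjugate j i * M' i j v := by
  let f : ContinuousMultilinearMap ℂ (fun _ : Fin n => Fin n → ℂ) ℂ :=
    { toMultilinearMap := (Matrix.detRowAlternating (R := ℂ) (n := Fin n)).toMultilinearMap
      cont := by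
        change Continuous (fun M : Matrix (Fin n) (Fin n) ℂ => M.det)
        exact continuous_id.matrix_det }
  have hM2 : HasFDerivAt (fun w' => (M w' : Fin n → Fin n → ℂ))
      (ContinuousLinearMap.pi fun i => ContinuousLinearMap.pi fun j => M' i j) w := by
    refine hasFDerivAt_pi.2 fun i => hasFDerivAt_pi.2 fun j => hM i j
  refine ⟨_, (f.hasFDerivAt (M w)).comp w hM2, fun v => ?_⟩
  refine (ContinuousMultilinearMap.linearDeriv_apply f (M w)
    (fun i j => M' i j v)).trans ?_
  refine Finset.sum_congr rfl fun i _ => ?_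
  change ((M w).updateRow i (fun j => M' i j v)).det = _
  rw [← Matrix.cramer_transpose_apply, Matrix.cramer_eq_adjugate_mulVec,
    ← Matrix.adjugate_transpose]
  rfl

/-- Wirtinger derivative of the log of a sum of squared moduli of holomorphic functions. -/
lemma wirt_log_normSq {ι κ : Type*} [Fintype ι] [DecidableEq ι] [Fintype κ]
    (h : κ → (ι → ℂ) → ℂ) (w : ι → ℂ) (hd : ∀ k, DifferentiableAt ℂ (h k) w)
    (hpos : ∑ k, Complex.normSq (h k w) ≠ 0) :
    DifferentiableAt ℝ (fun w' => Real.log (∑ k, Complex.normSq (h k w'))) w ∧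
    ∀ j, wirtingerDeriv
        (fun w' => ((Real.log (∑ k, Complex.normSq (h k w')) : ℝ) : ℂ)) w j
      = (∑ k, conj (h k w) * fderiv ℂ (h k) w (Pi.single j 1))
          / ((∑ k, Complex.normSq (h k w) : ℝ) : ℂ) := by
  have hr : ∀ k, HasFDerivAt (h k) ((fderiv ℂ (h k) w).restrictScalars ℝ) w := fun k =>
    (hd k).hasFDerivAt.restrictScalars ℝ
  have hre : ∀ k, HasFDerivAt (fun w' => (h k w').re)
      (Complex.reCLM.comp ((fderiv ℂ (h k) w).restrictScalars ℝ)) w := fun k =>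
    Complex.reCLM.hasFDerivAt.comp w (hr k)
  have him : ∀ k, HasFDerivAt (fun w' => (h k w').im)
      (Complex.imCLM.comp ((fderiv ℂ (h k) w).restrictScalars ℝ)) w := fun k =>
    Complex.imCLM.hasFDerivAt.comp w (hr k)
  have hsum : HasFDerivAt (fun w' => ∑ k, Complex.normSq (h k w')) _ w :=
    HasFDerivAt.fun_sum (u := Finset.univ) fun k _ =>
      ((hre k).mul (hre k)).add ((him k).mul (him k))
  have hlog := hsum.log hpos
  refine ⟨hlog.differentiableAt, fun j => ?_⟩
  have hc := Complex.ofRealCLM.hasFDerivAt.comp w hlog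
  have hI : ∀ k, fderiv ℂ (h k) w (Pi.single j Complex.I)
      = Complex.I * fderiv ℂ (h k) w (Pi.single j 1) := by
    intro k
    rw [← smul_eq_mul, ← map_smul]
    congr 1
    ext l
    by_cases hl : l = j
    · subst hl; simp
    · simp [hl]
  have hc' : fderiv ℝ (fun w' => ((Real.log (∑ k, Complex.normSq (h k w')) : ℝ) : ℂ)) w = _ :=
    hc.fderiv
  rw [wirtingerDeriv, hc']
  simp only [ContinuousLinearMap.comp_apply, smul_apply,
    sum_apply, add_apply,
    ContinuousLinearMap.coe_restrictScalars', hI, Complex.ofRealCLM_apply,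
    Complex.reCLM_apply, Complex.imCLM_apply, smul_eq_mul]
  push_cast
  rw [one_div, div_eq_inv_mul, mul_left_comm Complex.I, ← mul_sub, mul_left_comm ((2 : ℂ)⁻¹)]
  congr 1
  rw [Finset.mul_sum, ← Finset.sum_sub_distrib, Finset.mul_sum]
  refine Finset.sum_congr rfl fun k _ => ?_
  apply Complex.ext <;> simp <;> ring

lemma core_tangent {K I J : Type*} [Fintype K] [Fintype I] [Fintype J]
    [DecidableEq I] [DecidableEq J]
    (α : K) (β : I → K) (e : J → K)
    (hsplit : ∀ φ : K → ℂ, ∑ k, φ k = φ α + ∑ i, φ (β i) + ∑ j, φ (e j))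
    (hcover : ∀ k : K, k = α ∨ k ∈ Set.range β ∨ k ∈ Set.range e)
    (P : I → K → ℂ) (D : K → J → ℂ) (V : K → ℂ)
    (A : Matrix I I ℂ) (hA : ∀ i j, A i j = P i (β j)) (hdet : IsUnit A.det)
    (hVα : V α = 0) (hDα : ∀ j, D α j = 0)
    (hDe : ∀ i j, D (e i) j = if i = j then 1 else 0)
    (hVP : ∀ i, ∑ q, P i q * V q = 0)
    (hT : ∀ i j, ∑ q, P i q * D q j = 0) (k : K) :
    ∑ j, V (e j) * D k j = V k := by
  have he : ∀ l, ∑ j, V (e j) * D (e l) j = V (e l) := by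
    intro l
    simp [hDe]
  have hα : ∑ j, V (e j) * D α j = V α := by simp [hDα, hVα]
  have hb : A.mulVec (fun i => ∑ j, V (e j) * D (β i) j - V (β i)) = 0 := by
    ext i
    have h1 : ∑ q, P i q * (∑ j, V (e j) * D q j - V q) = 0 := by
      simp only [mul_sub, Finset.sum_sub_distrib, hVP, Finset.mul_sum, sub_zero]
      rw [Finset.sum_comm]
      refine Finset.sum_eq_zero fun j _ => ?_
      rw [← mul_zero (V (e j)), ← hT i j, Finset.mul_sum]
      exact Finset.sum_congr rfl fun q _ => by ring
    rw [hsplit] at h1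
    simp only [he, hα, sub_self, mul_zero, Finset.sum_const_zero, add_zero, zero_add] at h1
    simp only [Matrix.mulVec, dotProduct, hA, Pi.zero_apply]
    exact h1
  have hb0 := Matrix.eq_zero_of_mulVec_eq_zero hdet.ne_zero hb
  rcases hcover k with rfl | ⟨i, rfl⟩ | ⟨j, rfl⟩
  · exact hα
  · exact sub_eq_zero.mp (congrFun hb0 i)
  · exact he j

lemma core_trace {K I J : Type*} [Fintype K] [Fintype I] [Fintype J]
    [DecidableEq I] [DecidableEq J]
    (α : K) (β : I → K) (e : J → K)
    (hsplit : ∀ φ : K → ℂ, ∑ k, φ k = φ α + ∑ i, φ (β i) + ∑ j, φ (e j))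
    (x : K → ℂ) (a : Matrix K K ℂ) (htr : ∑ k, a k k = 0) (c : Matrix I I ℂ) (d : I → ℂ)
    (P : I → K → ℂ) (H : I → K → K → ℂ) (D : K → J → ℂ) (L : K → ℂ) (m : ℂ)
    (hL : ∀ q, L q = ∑ p, a p q * x p)
    (hm : m = Fintype.card J + Fintype.card I + 1 - ∑ i, d i)
    (A : Matrix I I ℂ) (hA : ∀ i j, A i j = P i (β j)) (hdet : IsUnit A.det)
    (hxα : x α = 1) (hDα : ∀ j, D α j = 0)
    (hDe : ∀ i j, D (e i) j = if i = j then 1 else 0)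
    (hT : ∀ i j, ∑ q, P i q * D q j = 0)
    (hE0 : ∀ i, ∑ q, x q * P i q = 0)
    (hE1 : ∀ i r, ∑ q, x q * H i q r = (d i - 1) * P i r)
    (hX1 : ∀ i r, ∑ q, a r q * P i q + ∑ q, L q * H i q r = ∑ j, c i j * P j r) :
    ∑ l, (∑ i, a i (e l) * D i l - (D (e l) l * L α + x (e l) * ∑ i, a i α * D i l))
      - (∑ i, ∑ j, A.adjugate j i * ∑ q, H i q (β j) * (L q - x q * L α)) / A.det
      + m * L α = -∑ i, c i i := by
  obtain ⟨G, hG⟩ : ∃ G : Matrix I I ℂ, G = A⁻¹ := ⟨_, rfl⟩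
  have hAG : A * G = 1 := by rw [hG]; exact Matrix.mul_nonsing_inv A hdet
  have hGA : G * A = 1 := by rw [hG]; exact Matrix.nonsing_inv_mul A hdet
  have hadj : ∀ j i, A.adjugate j i = A.det * G j i := by
    intro j i
    rw [hG, Matrix.inv_def, Matrix.smul_apply, smul_eq_mul, Ring.inverse_eq_inv',
      mul_inv_cancel_left₀ hdet.ne_zero]
  have hAG' : ∀ i k, ∑ j, P i (β j) * G j k = if i = k then 1 else 0 := by
    intro i k
    have := congrFun (congrFun hAG i) k
    simpa [Matrix.mul_apply, hA, Matrix.one_apply] using this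
  have hGA' : ∀ i k, ∑ j, G i j * P j (β k) = if i = k then 1 else 0 := by
    intro i k
    have := congrFun (congrFun hGA i) k
    simpa [Matrix.mul_apply, hA, Matrix.one_apply] using this
  have hDe' : ∀ l l' : J, D (e l) l' = if l = l' then 1 else 0 := hDe
  -- solve for the normal derivatives
  have hGe : ∀ j l, ∑ i, G j i * P i (e l) = - D (β j) l := by
    intro j l
    have h1 : ∑ i, G j i * ∑ q, P i q * D q l = 0 := by simp [hT]
    simp only [hsplit (fun q => P _ q * D q l), hDα, hDe, mul_zero, zero_add, mul_add,
      Finset.sum_add_distrib, mul_ite, mul_one, Finset.sum_ite_eq', Finset.mem_univ,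
      if_true] at h1
    have h2 : ∑ i, G j i * ∑ k, P i (β k) * D (β k) l = D (β j) l := by
      simp only [Finset.mul_sum]
      rw [Finset.sum_comm]
      simp only [← mul_assoc, ← Finset.sum_mul, hGA', ite_mul, one_mul, zero_mul,
        Finset.sum_ite_eq, Finset.mem_univ, if_true]
    rw [h2] at h1
    linear_combination h1
  have hGα : ∀ j, ∑ i, G j i * P i α = - x (β j) + ∑ l, x (e l) * D (β j) l := by
    intro j
    have h1 : ∑ i, G j i * ∑ q, x q * P i q = 0 := by simp [hE0]
    simp only [hsplit (fun q => x q * P _ q), hxα, one_mul, mul_add,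
      Finset.sum_add_distrib] at h1
    have h2 : ∑ i, G j i * ∑ k, x (β k) * P i (β k) = x (β j) := by
      simp only [Finset.mul_sum]
      rw [Finset.sum_comm]
      simp only [mul_left_comm (G _ _), ← Finset.mul_sum, hGA', mul_ite, mul_one, mul_zero,
        Finset.sum_ite_eq, Finset.mem_univ, if_true]
    have h3 : ∑ i, G j i * ∑ k, x (e k) * P i (e k) = - ∑ l, x (e l) * D (β j) l := by
      simp only [Finset.mul_sum]
      rw [Finset.sum_comm]
      simp only [mul_left_comm (G _ _), ← Finset.mul_sum, hGe, mul_neg,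
        Finset.sum_neg_distrib]
    rw [h2, h3] at h1
    linear_combination h1
  have hH : ∀ i r, ∑ q, H i q r * (L q - x q * L α)
      = ∑ k, c i k * P k r - ∑ q, a r q * P i q - L α * (d i - 1) * P i r := by
    intro i r
    have h1 : ∑ q, H i q r * (L q - x q * L α)
        = ∑ q, L q * H i q r - L α * ∑ q, x q * H i q r := by
      rw [Finset.mul_sum, ← Finset.sum_sub_distrib]
      exact Finset.sum_congr rfl fun q _ => by ring
    rw [h1, hE1]
    linear_combination hX1 i r
  have hdetne := hdet.ne_zero
  have hS : (∑ i, ∑ j, A.adjugate j i * ∑ q, H i q (β j) * (L q - x q * L α)) / A.det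
      = ∑ i, c i i - L α * (∑ i, d i - Fintype.card I)
        - ∑ j, (a (β j) (β j) + a (β j) α * (- x (β j) + ∑ l, x (e l) * D (β j) l)
          - ∑ l, a (β j) (e l) * D (β j) l) := by
    rw [div_eq_iff hdetne, mul_comm _ A.det]
    simp only [hadj, hH, mul_assoc A.det, ← Finset.mul_sum]
    congr 1
    have t1 : ∑ i, ∑ j, G j i * ∑ k, c i k * P k (β j) = ∑ i, c i i := by
      refine Finset.sum_congr rfl fun i _ => ?_
      simp only [Finset.mul_sum]
      rw [Finset.sum_comm]
      have : ∀ k, ∑ j, G j i * (c i k * P k (β j)) = c i k * ∑ j, P k (β j) * G j i := by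
        intro k
        rw [Finset.mul_sum]
        exact Finset.sum_congr rfl fun j _ => by ring
      simp only [this, hAG', mul_ite, mul_one, mul_zero, Finset.sum_ite_eq', Finset.mem_univ,
        if_true]
    have t3 : ∑ i, ∑ j, G j i * (L α * (d i - 1) * P i (β j))
        = L α * (∑ i, d i - Fintype.card I) := by
      have : ∀ i, ∑ j, G j i * (L α * (d i - 1) * P i (β j)) = L α * (d i - 1) := by
        intro i
        have h := hAG' i i
        rw [if_pos rfl] at h
        calc ∑ j, G j i * (L α * (d i - 1) * P i (β j))
            = L α * (d i - 1) * ∑ j, P i (β j) * G j i := by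
              rw [Finset.mul_sum]
              exact Finset.sum_congr rfl fun j _ => by ring
          _ = L α * (d i - 1) := by rw [h, mul_one]
      simp only [this, ← Finset.mul_sum, Finset.sum_sub_distrib]
      simp
    have t2 : ∑ i, ∑ j, G j i * ∑ q, a (β j) q * P i q
        = ∑ j, (a (β j) (β j) + a (β j) α * (- x (β j) + ∑ l, x (e l) * D (β j) l)
          - ∑ l, a (β j) (e l) * D (β j) l) := by
      rw [Finset.sum_comm]
      refine Finset.sum_congr rfl fun j _ => ?_
      have : ∑ i, G j i * ∑ q, a (β j) q * P i q = ∑ q, a (β j) q * ∑ i, G j i * P i q := by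
        simp only [Finset.mul_sum]
        rw [Finset.sum_comm]
        exact Finset.sum_congr rfl fun q _ => Finset.sum_congr rfl fun i _ => by ring
      rw [this, hsplit]
      simp only [hGα, hGe, hGA', mul_ite, mul_one, mul_zero, Finset.sum_ite_eq,
        Finset.mem_univ, if_true, mul_neg, Finset.sum_neg_distrib]
      ring
    have t4 : ∑ i, ∑ j, G j i * (∑ k, c i k * P k (β j) - ∑ q, a (β j) q * P i q
          - L α * (d i - 1) * P i (β j))
        = ∑ i, ∑ j, G j i * ∑ k, c i k * P k (β j)
          - ∑ i, ∑ j, G j i * ∑ q, a (β j) q * P i q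
          - ∑ i, ∑ j, G j i * (L α * (d i - 1) * P i (β j)) := by
      simp only [← Finset.sum_sub_distrib]
      exact Finset.sum_congr rfl fun i _ => Finset.sum_congr rfl fun j _ => by ring
    rw [t4, t1, t2, t3]
    ring
  rw [hS]
  have hdiv : ∑ l, (∑ i, a i (e l) * D i l
        - (D (e l) l * L α + x (e l) * ∑ i, a i α * D i l))
      = ∑ l, a (e l) (e l) + ∑ l, ∑ j, a (β j) (e l) * D (β j) l - Fintype.card J * L α
        - ∑ l, a (e l) α * x (e l) - ∑ l, x (e l) * ∑ j, a (β j) α * D (β j) l := by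
    have : ∀ l, (∑ i, a i (e l) * D i l
        - (D (e l) l * L α + x (e l) * ∑ i, a i α * D i l))
      = a (e l) (e l) + ∑ j, a (β j) (e l) * D (β j) l - L α
        - a (e l) α * x (e l) - x (e l) * ∑ j, a (β j) α * D (β j) l := by
      intro l
      rw [hsplit (fun i => a i (e l) * D i l), hsplit (fun i => a i α * D i l)]
      simp only [hDα, hDe, mul_ite, mul_one, mul_zero, Finset.sum_ite_eq', Finset.mem_univ,
        if_true]
      ring
    simp only [this, Finset.sum_sub_distrib, Finset.sum_add_distrib]
    simp
  rw [hdiv]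
  have hLα := hL α
  rw [hsplit, hxα] at hLα
  rw [hsplit] at htr
  simp only [mul_add, mul_neg, Finset.sum_sub_distrib, Finset.sum_add_distrib,
    Finset.sum_neg_distrib]
  have s1 : ∑ l, ∑ j, a (β j) (e l) * D (β j) l = ∑ j, ∑ l, a (β j) (e l) * D (β j) l :=
    Finset.sum_comm
  have s2 : ∑ l, x (e l) * ∑ j, a (β j) α * D (β j) l
      = ∑ j, a (β j) α * ∑ l, x (e l) * D (β j) l := by
    simp only [Finset.mul_sum]
    rw [Finset.sum_comm]
    exact Finset.sum_congr rfl fun q _ => Finset.sum_congr rfl fun i _ => by ring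
  rw [s1, s2, hm]
  linear_combination htr + hLα

lemma wirt_congr {ι : Type*} [Fintype ι] [DecidableEq ι]
    {f g : (ι → ℂ) → ℂ} {w : ι → ℂ} (h : f =ᶠ[nhds w] g) (j : ι) :
    wirtingerDeriv f w j = wirtingerDeriv g w j := by
  rw [wirtingerDeriv, wirtingerDeriv, h.fderiv_eq]

lemma wirt_comb {ι : Type*} [Fintype ι] [DecidableEq ι]
    (u v t : (ι → ℂ) → ℝ) (w : ι → ℂ) (m : ℝ) (hu : DifferentiableAt ℝ u w)
    (hv : DifferentiableAt ℝ v w) (ht : DifferentiableAt ℝ t w) (j : ι) :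
    wirtingerDeriv (fun w' => ((-(u w' + v w' + m * t w') : ℝ) : ℂ)) w j
      = -(wirtingerDeriv (fun w' => (u w' : ℂ)) w j
        + wirtingerDeriv (fun w' => (v w' : ℂ)) w j
        + m * wirtingerDeriv (fun w' => (t w' : ℂ)) w j) := by
  have key : ∀ {u : (ι → ℂ) → ℝ}, DifferentiableAt ℝ u w →
      fderiv ℝ (fun w' => (u w' : ℂ)) w = Complex.ofRealCLM.comp (fderiv ℝ u w) := fun h =>
    (Complex.ofRealCLM.hasFDerivAt.comp w h.hasFDerivAt).fderiv
  have hc := ((hu.hasFDerivAt.fun_add hv.hasFDerivAt).fun_add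
    (ht.hasFDerivAt.const_mul m)).fun_neg
  simp only [wirtingerDeriv]
  rw [key hc.differentiableAt, key hu, key hv, key ht, hc.fderiv]
  simp only [ContinuousLinearMap.comp_apply, neg_apply, add_apply, smul_apply,
    Complex.ofRealCLM_apply, smul_eq_mul]
  push_cast
  ring

lemma diff_conj {E : Type*} [NormedAddCommGroup E] [NormedSpace ℝ E] {h : E → ℂ} {w : E}
    (hh : DifferentiableAt ℝ h w) : DifferentiableAt ℝ (fun w' => conj (h w')) w :=
  (Complex.conjCLE.toContinuousLinearMap.differentiableAt).comp w hh

lemma diff_det {E : Type*} [NormedAddCommGroup E] [NormedSpace ℝ E] {n : ℕ}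
    {M : E → Matrix (Fin n) (Fin n) ℂ} {w : E}
    (hM : ∀ i j, DifferentiableAt ℝ (fun w' => M w' i j) w) :
    DifferentiableAt ℝ (fun w' => (M w').det) w := by
  simp only [Matrix.det_apply']
  refine DifferentiableAt.fun_sum fun σ _ => ?_
  refine DifferentiableAt.const_mul ?_ _
  exact (HasFDerivAt.finsetProd (u := Finset.univ) (g := fun i w' => M w' (σ i) i)
    fun i _ => (hM (σ i) i).hasFDerivAt).differentiableAt

lemma diff_metric {ι : Type*} [Fintype ι] [DecidableEq ι] {N n : ℕ} (α : Fin (N + 1))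
    (z : (ι → ℂ) → (Fin (N + 1) → ℂ)) (w : ι → ℂ)
    (hz : ∀ k, AnalyticAt ℂ (fun w' => z w' k) w)
    (Q : (Fin (N + 1) → ℂ) → ℝ)
    (hQ : ∀ x, Q x = 1 + ∑ k ∈ Finset.univ.erase α, Complex.normSq (x k))
    (gFS : Fin (N + 1) → Fin (N + 1) → (Fin (N + 1) → ℂ) → ℂ)
    (hgFS : ∀ p q x, gFS p q x =
      ((Q x : ℂ) * (if p = q then 1 else 0) - conj (x p) * x q) / (Q x : ℂ) ^ 2)
    (gmat : (ι → ℂ) → Matrix (Fin n) (Fin n) ℂ) (v : Fin n → ι → ℂ)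
    (hgmat : ∀ w, gmat w = Matrix.of fun i j =>
      ∑ p ∈ Finset.univ.erase α, ∑ q ∈ Finset.univ.erase α,
        fderiv ℂ (fun w' => z w' p) w (v i) * gFS p q (z w) *
          conj (fderiv ℂ (fun w' => z w' q) w (v j))) :
    DifferentiableAt ℝ (fun w' => ((gmat w').det).re) w := by
  have hzr : ∀ k, DifferentiableAt ℝ (fun w' => z w' k) w := fun k =>
    (hz k).differentiableAt.restrictScalars ℝ
  have hdr : ∀ k u, DifferentiableAt ℝ (fun w' => fderiv ℂ (fun w'' => z w'' k) w' u) w := by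
    intro k u
    have h1 : DifferentiableAt ℂ (fun w' => fderiv ℂ (fun w'' => z w'' k) w' u) w :=
      (hz k).fderiv.differentiableAt.clm_apply (differentiableAt_const u)
    exact h1.restrictScalars ℝ
  have hQc : ∀ x, (Q x : ℂ) = 1 + ∑ k ∈ Finset.univ.erase α, conj (x k) * x k := by
    intro x
    rw [hQ]
    push_cast
    simp only [Complex.normSq_eq_conj_mul_self]
  have hQd : DifferentiableAt ℝ (fun w' => (Q (z w') : ℂ)) w := by
    simp only [hQc]
    refine (differentiableAt_const _).fun_add (DifferentiableAt.fun_sum fun k _ => ?_)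
    exact (diff_conj (hzr k)).fun_mul (hzr k)
  have hQ0 : ∀ x, (Q x : ℂ) ≠ 0 := by
    intro x
    rw [Complex.ofReal_ne_zero, hQ]
    have : 0 ≤ ∑ k ∈ Finset.univ.erase α, Complex.normSq (x k) :=
      Finset.sum_nonneg fun k _ => Complex.normSq_nonneg _
    linarith
  have hdet : DifferentiableAt ℝ (fun w' => (gmat w').det) w := by
    refine diff_det fun i j => ?_
    simp only [hgmat, Matrix.of_apply, hgFS]
    refine DifferentiableAt.fun_sum fun p _ => DifferentiableAt.fun_sum fun q _ => ?_
    refine ((hdr p _).fun_mul ?_).fun_mul (diff_conj (hdr q _))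
    have h1 := (hQd.fun_mul (differentiableAt_const (if p = q then (1 : ℂ) else 0))).fun_sub
      ((diff_conj (hzr p)).fun_mul (hzr q))
    simp only [div_eq_mul_inv]
    exact h1.fun_mul ((hQd.fun_pow 2).fun_inv (pow_ne_zero _ (hQ0 _)))
  exact Complex.reCLM.differentiableAt.comp w hdet

lemma sum_split {N s : ℕ} (α : Fin (N + 1)) (β : Fin s → Fin (N + 1))
    (e : Fin (N - s) → Fin (N + 1))
    (hβ : Function.Injective β) (he : Function.Injective e)
    (hβα : ∀ i, β i ≠ α) (heα : ∀ j, e j ≠ α) (hβe : ∀ i j, β i ≠ e j)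
    (hcover : ∀ k : Fin (N + 1), k = α ∨ k ∈ Set.range β ∨ k ∈ Set.range e)
    (φ : Fin (N + 1) → ℂ) : ∑ k, φ k = φ α + ∑ i, φ (β i) + ∑ j, φ (e j) := by
  let g : (Unit ⊕ Fin s) ⊕ Fin (N - s) → Fin (N + 1) := Sum.elim (Sum.elim (fun _ => α) β) e
  have hg : Function.Bijective g := by
    constructor
    · rintro ((⟨⟩ | i) | j) ((⟨⟩ | i') | j') h <;> simp only [g, Sum.elim_inl, Sum.elim_inr] at h
      · rfl
      · exact absurd h.symm (hβα _)
      · exact absurd h.symm (heα _)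
      · exact absurd h (hβα _)
      · rw [hβ h]
      · exact absurd h (hβe _ _)
      · exact absurd h (heα _)
      · exact absurd h.symm (hβe _ _)
      · rw [he h]
    · intro k
      rcases hcover k with rfl | ⟨i, rfl⟩ | ⟨j, rfl⟩
      · exact ⟨Sum.inl (Sum.inl ()), rfl⟩
      · exact ⟨Sum.inl (Sum.inr i), rfl⟩
      · exact ⟨Sum.inr j, rfl⟩
  rw [← hg.sum_comp]
  simp [Fintype.sum_sum_type, g]

lemma eval_euler {n k : ℕ} {F : MvPolynomial (Fin n) ℂ} (hF : F.IsHomogeneous k)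
    (x : Fin n → ℂ) :
    ∑ q, x q * MvPolynomial.eval x (MvPolynomial.pderiv q F) = k * MvPolynomial.eval x F := by
  have h := congrArg (MvPolynomial.eval x) hF.sum_X_mul_pderiv
  simpa [map_sum] using h

lemma eval_euler' {n k : ℕ} {F : MvPolynomial (Fin n) ℂ} (hF : F.IsHomogeneous k)
    (x : Fin n → ℂ) (r : Fin n) :
    ∑ q, x q * MvPolynomial.eval x (MvPolynomial.pderiv r (MvPolynomial.pderiv q F))
      = ((k : ℂ) - 1) * MvPolynomial.eval x (MvPolynomial.pderiv r F) := by
  have h := congrArg (fun p => MvPolynomial.eval x (MvPolynomial.pderiv r p))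
    hF.sum_X_mul_pderiv
  simp only [map_sum, MvPolynomial.pderiv_mul, MvPolynomial.pderiv_X, Pi.single_apply, map_add,
    map_mul, MvPolynomial.eval_X, Finset.sum_add_distrib, map_nsmul, nsmul_eq_mul,
    apply_ite (MvPolynomial.eval x), map_one, map_zero, ite_mul, one_mul, zero_mul,
    Finset.sum_ite_eq, Finset.sum_ite_eq', Finset.mem_univ, if_true, smul_eq_mul,
    Derivation.map_natCast, map_natCast, zero_add] at h
  linear_combination h

lemma eval_XF {n s : ℕ} {F : Fin s → MvPolynomial (Fin n) ℂ}
    (a : Matrix (Fin n) (Fin n) ℂ) (c : Matrix (Fin s) (Fin s) ℂ) (i : Fin s)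
    (hXF : (∑ p, ∑ q, MvPolynomial.C (a p q) * MvPolynomial.X p *
        MvPolynomial.pderiv q (F i))
      = ∑ j, MvPolynomial.C (c i j) * F j) (x : Fin n → ℂ) :
    ∑ q, (∑ p, a p q * x p) * MvPolynomial.eval x (MvPolynomial.pderiv q (F i))
      = ∑ j, c i j * MvPolynomial.eval x (F j) := by
  have h := congrArg (MvPolynomial.eval x) hXF
  simp only [map_sum, map_mul, MvPolynomial.eval_X, MvPolynomial.eval_C] at h
  rw [← h, Finset.sum_comm]
  simp only [Finset.sum_mul]

lemma eval_XF' {n s : ℕ} {F : Fin s → MvPolynomial (Fin n) ℂ}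
    (a : Matrix (Fin n) (Fin n) ℂ) (c : Matrix (Fin s) (Fin s) ℂ) (i : Fin s)
    (hXF : (∑ p, ∑ q, MvPolynomial.C (a p q) * MvPolynomial.X p *
        MvPolynomial.pderiv q (F i))
      = ∑ j, MvPolynomial.C (c i j) * F j) (x : Fin n → ℂ) (r : Fin n) :
    ∑ q, a r q * MvPolynomial.eval x (MvPolynomial.pderiv q (F i))
      + ∑ q, (∑ p, a p q * x p) *
          MvPolynomial.eval x (MvPolynomial.pderiv r (MvPolynomial.pderiv q (F i)))
      = ∑ j, c i j * MvPolynomial.eval x (MvPolynomial.pderiv r (F j)) := by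
  have h := congrArg (fun p => MvPolynomial.eval x (MvPolynomial.pderiv r p)) hXF
  simp only [map_sum, mul_assoc, MvPolynomial.pderiv_C, MvPolynomial.pderiv_mul,
    MvPolynomial.pderiv_X, Pi.single_apply, map_add, map_mul, MvPolynomial.eval_X,
    MvPolynomial.eval_C, apply_ite (MvPolynomial.eval x), map_one, map_zero, ite_mul, one_mul,
    zero_mul, mul_add, Finset.sum_add_distrib, mul_ite, mul_zero,
    Finset.sum_const_zero, zero_add] at h
  rw [← h]
  congr 1
  · rw [Finset.sum_comm]
    simp
  · rw [Finset.sum_comm]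
    simp only [Finset.sum_mul, mul_assoc]

end TraceAux

/-- **Theorem 4.1 of the paper (trace identity for the divergence)**, in chart form.

Complete-intersection setting: `F i` homogeneous of degree `d i` cut out `M ⊂ CP^N`,
`m = N + 1 - Σ d_i`; in the chart datum `(α, β, e)` the variety is parametrized over
the open `W` by the holomorphic `z` with `z(w)_α = 1`, `z(w)_{e j} = w j`,
`F_i(z w) = 0`; `Q(z w) = 1 + ‖z‖²`, `g(w)` is the restricted Fubini–Study metric
matrix, `A(w) = (∂F_i^α/∂z_{β_j})(z w)`, `ξ(w) = det g·|det A|²·Q^m`, `f = -log ξ`.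
The traceless matrix `a` defines `X = Σ a_{ij} Z_i ∂/∂Z_j`, which satisfies
`X F_i = Σ_j c_{ij} F_j`, `κ = trace c`; its chart components are
`X̃^k(x) = a_{αk} + Σ_{i≠α} a_{ik} x_i - x_k (a_{αα} + Σ_{i≠α} a_{iα} x_i)`, its
restriction to `M` has components `X^j(w) = X̃^{e j}(z w)`,
`div X = Σ_j ∂X^j/∂w^j + Σ_j X^j ∂(log det g)/∂w^j`,
`X(f) = Σ_j X^j ∂f/∂w^j` and `θ(x) = -(Σ a_{ij} x_i conj(x_j))/(Σ_k |x_k|²)`.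
Then on the chart: `div X + X(f) - m·θ = -κ`. -/
theorem divergence_trace_identity
    (N s : ℕ) (hN : 1 ≤ N) (hs1 : 1 ≤ s) (hsN : s ≤ N)
    (d : Fin s → ℕ) (F : Fin s → MvPolynomial (Fin (N + 1)) ℂ)
    (hF : ∀ i, (F i).IsHomogeneous (d i))
    (m : ℤ) (hm : m = (N + 1 : ℤ) - ∑ i, (d i : ℤ))
    -- the holomorphic vector field
    (a : Matrix (Fin (N + 1)) (Fin (N + 1)) ℂ)
    (htrace : Matrix.trace a = 0)
    (c : Matrix (Fin s) (Fin s) ℂ)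
    (hXF : ∀ i, (∑ p, ∑ q, MvPolynomial.C (a p q) * MvPolynomial.X p *
        MvPolynomial.pderiv q (F i))
      = ∑ j, MvPolynomial.C (c i j) * F j)
    -- chart datum for `M_reg`
    (α : Fin (N + 1)) (β : Fin s → Fin (N + 1)) (e : Fin (N - s) → Fin (N + 1))
    (hβ : Function.Injective β) (he : Function.Injective e)
    (hβα : ∀ i, β i ≠ α) (heα : ∀ j, e j ≠ α) (hβe : ∀ i j, β i ≠ e j)
    (hcover : ∀ k : Fin (N + 1), k = α ∨ k ∈ Set.range β ∨ k ∈ Set.range e)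
    (W : Set (Fin (N - s) → ℂ)) (hW : IsOpen W)
    (z : (Fin (N - s) → ℂ) → (Fin (N + 1) → ℂ))
    (hz : AnalyticOnNhd ℂ z W)
    (hz1 : ∀ w ∈ W, z w α = 1)
    (hze : ∀ w ∈ W, ∀ j, z w (e j) = w j)
    (hzF : ∀ w ∈ W, ∀ i, MvPolynomial.eval (z w) (F i) = 0)
    (Q : (Fin (N + 1) → ℂ) → ℝ)
    (hQ : ∀ x, Q x = 1 + ∑ k ∈ Finset.univ.erase α, Complex.normSq (x k))
    (gFS : Fin (N + 1) → Fin (N + 1) → (Fin (N + 1) → ℂ) → ℂ)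
    (hgFS : ∀ p q x, gFS p q x =
      ((Q x : ℂ) * (if p = q then 1 else 0) - conj (x p) * x q) / (Q x : ℂ) ^ 2)
    (gmat : (Fin (N - s) → ℂ) → Matrix (Fin (N - s)) (Fin (N - s)) ℂ)
    (hgmat : ∀ w, gmat w = Matrix.of fun i j =>
      ∑ p ∈ Finset.univ.erase α, ∑ q ∈ Finset.univ.erase α,
        fderiv ℂ (fun w' => z w' p) w (Pi.single i 1) * gFS p q (z w) *
          conj (fderiv ℂ (fun w' => z w' q) w (Pi.single j 1)))
    (A : (Fin (N - s) → ℂ) → Matrix (Fin s) (Fin s) ℂ)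
    (hA : ∀ w, A w = Matrix.of fun i j =>
      MvPolynomial.eval (z w) (MvPolynomial.pderiv (β j) (F i)))
    (hAunit : ∀ w ∈ W, IsUnit (A w).det)
    (hgpos : ∀ w ∈ W, 0 < ((gmat w).det).re)
    -- the potential `f = -log ξ`
    (f : (Fin (N - s) → ℂ) → ℝ)
    (hf : ∀ w, f w = -Real.log
      (((gmat w).det).re * Complex.normSq ((A w).det) * Q (z w) ^ m))
    -- the chart components of `X` and its restriction to `M`
    (Xt : Fin (N + 1) → (Fin (N + 1) → ℂ) → ℂ)
    (hXt : ∀ k x, Xt k x =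
      a α k + (∑ i ∈ Finset.univ.erase α, a i k * x i)
        - x k * (a α α + ∑ i ∈ Finset.univ.erase α, a i α * x i))
    (Xcomp : Fin (N - s) → (Fin (N - s) → ℂ) → ℂ)
    (hXcomp : ∀ j w, Xcomp j w = Xt (e j) (z w))
    -- divergence, `X(f)` and `θ`
    (divX : (Fin (N - s) → ℂ) → ℂ)
    (hdivX : ∀ w, divX w =
      (∑ j, fderiv ℂ (fun w' => Xcomp j w') w (Pi.single j 1))
        + ∑ j, Xcomp j w *
            wirtingerDeriv (fun w' => ((Real.log (((gmat w').det).re) : ℝ) : ℂ)) w j)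
    (Xf : (Fin (N - s) → ℂ) → ℂ)
    (hXf : ∀ w, Xf w = ∑ j, Xcomp j w *
      wirtingerDeriv (fun w' => ((f w' : ℝ) : ℂ)) w j)
    (θ : (Fin (N + 1) → ℂ) → ℂ)
    (hθ : ∀ x, θ x = -(∑ i, ∑ j, a i j * x i * conj (x j))
      / (∑ k, (Complex.normSq (x k) : ℂ))) :
    ∀ w ∈ W, divX w + Xf w - (m : ℂ) * θ (z w) = -Matrix.trace c := by
  intro w hw
  have hWn : ∀ᶠ w' in nhds w, w' ∈ W := hW.mem_nhds hw
  have hza : ∀ k, AnalyticAt ℂ (fun w' => z w' k) w := fun k =>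
    analyticAt_pi_iff.1 (hz w hw) k
  have hzd : ∀ k, HasFDerivAt (fun w' => z w' k) (fderiv ℂ (fun w' => z w' k) w) w :=
    fun k => (hza k).differentiableAt.hasFDerivAt
  have hsplit := TraceAux.sum_split α β e hβ he hβα heα hβe hcover
  have hxα := hz1 w hw
  obtain ⟨D, hD⟩ : ∃ D : Fin (N + 1) → Fin (N - s) → ℂ,
    D = fun k j => fderiv ℂ (fun w' => z w' k) w (Pi.single j 1) := ⟨_, rfl⟩
  have hD' : ∀ k j, fderiv ℂ (fun w' => z w' k) w (Pi.single j 1) = D k j := by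
    intro k j; rw [hD]
  obtain ⟨P, hP⟩ : ∃ P : Fin s → Fin (N + 1) → ℂ, ∀ i q,
    MvPolynomial.eval (z w) (MvPolynomial.pderiv q (F i)) = P i q := ⟨_, fun _ _ => rfl⟩
  obtain ⟨H, hH⟩ : ∃ H : Fin s → Fin (N + 1) → Fin (N + 1) → ℂ, ∀ i q r,
    MvPolynomial.eval (z w) (MvPolynomial.pderiv q (MvPolynomial.pderiv r (F i))) = H i q r :=
    ⟨_, fun _ _ _ => rfl⟩
  have hH' : ∀ i q r,
      MvPolynomial.eval (z w) (MvPolynomial.pderiv r (MvPolynomial.pderiv q (F i))) = H i q r := by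
    intro i q r
    rw [TraceAux.pderiv_pderiv_comm, hH]
  obtain ⟨L, hL⟩ : ∃ L : Fin (N + 1) → ℂ, ∀ q, L q = ∑ p, a p q * z w p := ⟨_, fun _ => rfl⟩
  have hDα : ∀ j, D α j = 0 := by
    intro j
    have h : (fun w' => z w' α) =ᶠ[nhds w] fun _ => 1 := hWn.mono fun w' h' => hz1 w' h'
    rw [← hD', h.fderiv_eq]
    simp
  have hDe : ∀ i j, D (e i) j = if i = j then 1 else 0 := by
    intro i j
    have h : (fun w' => z w' (e i)) =ᶠ[nhds w] fun w' => w' i :=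
      hWn.mono fun w' h' => hze w' h' i
    rw [← hD', h.fderiv_eq, (hasFDerivAt_apply i w).fderiv]
    simp [Pi.single_apply]
  have hT : ∀ i j, ∑ q, P i q * D q j = 0 := by
    intro i j
    have h : (fun w' => MvPolynomial.eval (z w') (F i)) =ᶠ[nhds w] fun _ => 0 :=
      hWn.mono fun w' h' => hzF w' h' i
    have h1 := (TraceAux.hasFDerivAt_eval z _ w hzd (F i)).fderiv
    rw [h.fderiv_eq] at h1
    have h2 := congrArg (fun T => T (Pi.single j 1)) h1
    simp only [sum_apply, smul_apply, smul_eq_mul, hP, hD'] at h2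
    rw [← h2]
    simp
  have hE0 : ∀ i, ∑ q, z w q * P i q = 0 := by
    intro i
    have h := TraceAux.eval_euler (hF i) (z w)
    rw [hzF w hw i, mul_zero] at h
    simpa only [hP] using h
  have hE1 : ∀ i r, ∑ q, z w q * H i q r = ((d i : ℂ) - 1) * P i r := by
    intro i r
    have h := TraceAux.eval_euler' (hF i) (z w) r
    simpa only [hP, hH'] using h
  have hX0 : ∀ i, ∑ q, L q * P i q = 0 := by
    intro i
    have h := TraceAux.eval_XF a c i (hXF i) (z w)
    simpa only [hP, ← hL, hzF w hw, mul_zero, Finset.sum_const_zero] using h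
  have hX1 : ∀ i r, ∑ q, a r q * P i q + ∑ q, L q * H i q r = ∑ j, c i j * P j r := by
    intro i r
    have h := TraceAux.eval_XF' a c i (hXF i) (z w) r
    simpa only [hP, hH', ← hL] using h
  have hdet := hAunit w hw
  have hAP : ∀ i j, A w i j = P i (β j) := by
    intro i j
    rw [hA, Matrix.of_apply, hP]
  have htan := TraceAux.core_tangent α β e hsplit hcover P D (fun q => L q - z w q * L α) (A w)
    hAP hdet (by simp [hxα]) hDα hDe
    (by
      intro i
      have : ∑ q, P i q * (L q - z w q * L α)
          = ∑ q, L q * P i q - L α * ∑ q, z w q * P i q := by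
        rw [Finset.mul_sum, ← Finset.sum_sub_distrib]
        exact Finset.sum_congr rfl fun q _ => by ring
      rw [this, hX0, hE0]; ring) hT
  have hcore := TraceAux.core_trace α β e hsplit (z w) a (by simpa [Matrix.trace] using htrace)
    c (fun i => (d i : ℂ)) P H D L (m : ℂ) hL
    (by
      rw [hm, Fintype.card_fin, Fintype.card_fin, Nat.cast_sub hsN]
      push_cast
      ring) (A w) hAP hdet hxα hDα hDe hT hE0 hE1 hX1
  -- the chart components
  have hXt' : ∀ w' ∈ W, ∀ k, Xt k (z w')
      = ∑ i, a i k * z w' i - z w' k * ∑ i, a i α * z w' i := by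
    intro w' h' k
    rw [hXt, ← Finset.add_sum_erase Finset.univ (fun i => a i k * z w' i) (Finset.mem_univ α),
      ← Finset.add_sum_erase Finset.univ (fun i => a i α * z w' i) (Finset.mem_univ α), hz1 w' h',
      mul_one, mul_one]
  have hXc : ∀ j, Xcomp j w = L (e j) - z w (e j) * L α := by
    intro j
    rw [hXcomp, hXt' w hw, hL, hL]
  have hdiv : ∀ j, fderiv ℂ (fun w' => Xcomp j w') w (Pi.single j 1)
      = ∑ i, a i (e j) * D i j - (D (e j) j * L α + z w (e j) * ∑ i, a i α * D i j) := by
    intro j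
    have h : (fun w' => Xcomp j w') =ᶠ[nhds w]
        fun w' => ∑ i, a i (e j) * z w' i - z w' (e j) * ∑ i, a i α * z w' i :=
      hWn.mono fun w' h' => by
        simp only [hXcomp]
        exact hXt' w' h' (e j)
    have hs : ∀ k, HasFDerivAt (fun w' => ∑ i, a i k * z w' i) _ w := fun k =>
      HasFDerivAt.fun_sum (u := Finset.univ) fun i _ => (hzd i).const_mul (a i k)
    rw [h.fderiv_eq, ((hs (e j)).fun_sub ((hzd (e j)).fun_mul (hs α))).fderiv]
    simp only [sub_apply, add_apply, sum_apply, smul_apply, smul_eq_mul, hD', hL]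
    ring
  -- the logarithmic derivatives
  have hAd : ∀ i j, HasFDerivAt (fun w' => A w' i j)
      (∑ k, H i k (β j) • fderiv ℂ (fun w' => z w' k) w) w := by
    intro i j
    simp only [hA, Matrix.of_apply, ← hH]
    exact TraceAux.hasFDerivAt_eval z _ w hzd _
  obtain ⟨T, hTd, hTv⟩ := TraceAux.det_hasFDerivAt A _ w hAd
  have hTX : ∑ j, Xcomp j w * T (Pi.single j 1)
      = ∑ i, ∑ j, (A w).adjugate j i * ∑ q, H i q (β j) * (L q - z w q * L α) := by
    simp only [hTv, sum_apply, smul_apply, smul_eq_mul, hD', hXc, Finset.mul_sum]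
    rw [Finset.sum_comm]
    refine Finset.sum_congr rfl fun i _ => ?_
    rw [Finset.sum_comm]
    refine Finset.sum_congr rfl fun j _ => ?_
    rw [Finset.sum_comm]
    refine Finset.sum_congr rfl fun q _ => ?_
    rw [← htan q, Finset.mul_sum, Finset.mul_sum]
    exact Finset.sum_congr rfl fun l _ => by ring
  have hWA := TraceAux.wirt_log_normSq (κ := Unit) (fun _ w' => (A w').det) w
    (fun _ => hTd.differentiableAt) (by simpa using hdet.ne_zero)
  simp only [Finset.univ_unique, Finset.sum_singleton, hTd.fderiv] at hWA
  have hQz : ∀ w' ∈ W, Q (z w') = ∑ k, Complex.normSq (z w' k) := by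
    intro w' h'
    rw [hQ, ← Finset.add_sum_erase Finset.univ (fun k => Complex.normSq (z w' k))
      (Finset.mem_univ α), hz1 w' h', map_one]
  have hQpos : ∀ x, 0 < Q x := by
    intro x
    rw [hQ]
    have : 0 ≤ ∑ k ∈ Finset.univ.erase α, Complex.normSq (x k) :=
      Finset.sum_nonneg fun k _ => Complex.normSq_nonneg _
    linarith
  have hWQ := TraceAux.wirt_log_normSq (fun k w' => z w' k) w
    (fun k => (hza k).differentiableAt) (by rw [← hQz w hw]; exact (hQpos _).ne')
  simp only [hD'] at hWQ
  have hg := (TraceAux.diff_metric α z w hza Q hQ gFS hgFS gmat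
    (fun i => Pi.single i 1) hgmat).log (hgpos w hw).ne'
  have hfe : (fun w' => ((f w' : ℝ) : ℂ)) =ᶠ[nhds w] fun w' =>
      ((-(Real.log (((gmat w').det).re) + Real.log (Complex.normSq (A w').det)
        + (m : ℝ) * Real.log (∑ k, Complex.normSq (z w' k))) : ℝ) : ℂ) := by
    refine hWn.mono fun w' h' => ?_
    have h1 := (hgpos w' h').ne'
    have h2 : Complex.normSq (A w').det ≠ 0 := by simpa using (hAunit w' h').ne_zero
    have h3 := (hQpos (z w')).ne'
    simp only [hf]
    rw [Real.log_mul (mul_ne_zero h1 h2) (zpow_ne_zero _ h3), Real.log_mul h1 h2,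
      Real.log_zpow, hQz w' h']
  have hWf : ∀ j, wirtingerDeriv (fun w' => ((f w' : ℝ) : ℂ)) w j = _ := fun j =>
    (TraceAux.wirt_congr hfe j).trans
      (TraceAux.wirt_comb _ _ _ w (m : ℝ) hg hWA.1 hWQ.1 j)
  have hA' : ∀ j, wirtingerDeriv
      (fun w' => ((Real.log (Complex.normSq (A w').det) : ℝ) : ℂ)) w j
      = T (Pi.single j 1) / (A w).det := by
    intro j
    rw [hWA.2 j, Complex.normSq_eq_conj_mul_self, mul_div_mul_left]
    exact (map_ne_zero _).2 hdet.ne_zero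
  have hsumA : ∑ j, Xcomp j w * wirtingerDeriv
      (fun w' => ((Real.log (Complex.normSq (A w').det) : ℝ) : ℂ)) w j
      = (∑ i, ∑ j, (A w).adjugate j i * ∑ q, H i q (β j) * (L q - z w q * L α))
        / (A w).det := by
    rw [← hTX, Finset.sum_div]
    exact Finset.sum_congr rfl fun j _ => by rw [hA']; ring
  have hS0 : (∑ k, (Complex.normSq (z w k) : ℂ)) ≠ 0 := by
    have h := (hQpos (z w)).ne'
    rw [hQz w hw] at h
    exact_mod_cast h
  have hsumQ : ∑ j, Xcomp j w * wirtingerDeriv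
      (fun w' => ((Real.log (∑ k, Complex.normSq (z w' k)) : ℝ) : ℂ)) w j
      = - θ (z w) - L α := by
    have h1 : ∑ j, Xcomp j w * ∑ k, conj (z w k) * D k j
        = ∑ i, ∑ k, a i k * z w i * conj (z w k)
          - L α * ∑ k, (Complex.normSq (z w k) : ℂ) := by
      have h2 : ∑ j, Xcomp j w * ∑ k, conj (z w k) * D k j
          = ∑ k, conj (z w k) * (L k - z w k * L α) := by
        simp only [Finset.mul_sum]
        rw [Finset.sum_comm]
        refine Finset.sum_congr rfl fun k _ => ?_
        rw [← htan k, Finset.mul_sum]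
        exact Finset.sum_congr rfl fun j _ => by rw [hXc]; ring
      rw [h2, Finset.sum_comm, Finset.mul_sum, ← Finset.sum_sub_distrib]
      refine Finset.sum_congr rfl fun k _ => ?_
      rw [Complex.normSq_eq_conj_mul_self, ← Finset.sum_mul, ← hL]
      ring
    have h3 : ∑ j, Xcomp j w * wirtingerDeriv
        (fun w' => ((Real.log (∑ k, Complex.normSq (z w' k)) : ℝ) : ℂ)) w j
        = (∑ j, Xcomp j w * ∑ k, conj (z w k) * D k j)
          / ∑ k, (Complex.normSq (z w k) : ℂ) := by
      rw [Finset.sum_div]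
      refine Finset.sum_congr rfl fun j _ => ?_
      rw [hWQ.2 j]
      push_cast
      ring
    rw [h3, h1, hθ]
    field_simp
  rw [hdivX, hXf]
  simp only [hWf, hdiv, mul_neg, mul_add, Finset.sum_add_distrib, Finset.sum_neg_distrib]
  simp only [mul_left_comm (Xcomp _ w), ← Finset.mul_sum, Complex.ofReal_intCast]
  rw [hsumA, hsumQ, Matrix.trace]
  simp only [Matrix.diag_apply]
  linear_combination hcore
end

section
/- In the complete-intersection setting below, let a = (a_{ij})_{0≤i,j≤N} be a traceless complex matrix, assume the vector field X = Σ_{i,j=0}^N a_{ij} Z_i ∂/∂Z_j satisfies X F_i = Σ_{j=1}^s c_{ij} F_j for a complex s×s matrix c, and let κ = trace(c). Let X̃^k(z) = a_{αk} + Σ_{i≠α} a_{ik} z_i^α − z_k^α (a_{αα} + Σ_{i≠α} a_{iα} z_i^α) be the chart components of X, and set X̃F_i^α := Σ_{k≠α} X̃^k ∂F_i^α/∂z_k^α. Then at every point of M_reg ∩ U_{αβ₁…β_s}: Σ_{i=1}^s Σ_{j=1}^s A^{ji} · ∂(X̃F_i^α)/∂z_{β_j}^α = κ − (Σ_{i=1}^s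 d_i)(a_{αα} + Σ_{j≠α} a_{jα} z_j^α), where A^{ji} = (A⁻¹)_{ji}. -/
open scoped BigOperators

/-- Derivative of the dehomogenization of a polynomial. -/
theorem aux_hasFDerivAt {N : ℕ} (α : Fin (N + 1))
    (hat : ({k : Fin (N + 1) // k ≠ α} → ℂ) → (Fin (N + 1) → ℂ))
    (hhat : ∀ z j, hat z j = if h : j = α then 1 else z ⟨j, h⟩)
    (z : {k : Fin (N + 1) // k ≠ α} → ℂ) (p : MvPolynomial (Fin (N + 1)) ℂ) :
    HasFDerivAt (fun z' => MvPolynomial.eval (hat z') p)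
      (∑ k : {k : Fin (N + 1) // k ≠ α}, MvPolynomial.eval (hat z) (MvPolynomial.pderiv k.1 p) •
        (ContinuousLinearMap.proj k : ({k : Fin (N + 1) // k ≠ α} → ℂ) →L[ℂ] ℂ)) z := by
  induction p using MvPolynomial.induction_on with
  | C r => 
    simp only [MvPolynomial.eval_C]
    refine (hasFDerivAt_const (𝕜 := ℂ) r z).congr_fderiv ?_
    ext v
    simp
  | add p q hp hq =>
    simp only [map_add]
    refine (hp.fun_add hq).congr_fderiv ?_
    ext v
    simp [add_mul, Finset.sum_add_distrib]
  | mul_X p n hp =>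
    have hX : HasFDerivAt (fun z' => hat z' n)
      (∑ k : {k : Fin (N + 1) // k ≠ α},
        MvPolynomial.eval (hat z) (MvPolynomial.pderiv k.1 (MvPolynomial.X n)) •
        (ContinuousLinearMap.proj k : ({k : Fin (N + 1) // k ≠ α} → ℂ) →L[ℂ] ℂ)) z := by
      by_cases h : n = α
      · have e : (fun z' => hat z' n) = fun _ => (1 : ℂ) := by
          funext z'; simp [hhat, h]
        rw [e]
        refine (hasFDerivAt_const (𝕜 := ℂ) (1 : ℂ) z).congr_fderiv ?_
        ext v
        simp only [sum_apply, smul_apply]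
        symm
        apply Finset.sum_eq_zero
        intro k _
        rw [MvPolynomial.pderiv_X_of_ne]
        · simp
        · rw [h]; exact fun h' => k.2 h'.symm
      · have e : (fun z' => hat z' n) = fun z' => z' ⟨n, h⟩ := by
          funext z'; simp [hhat, h]
        rw [e]
        refine (ContinuousLinearMap.proj (R := ℂ) (φ := fun _ => ℂ)
          (⟨n, h⟩ : {k : Fin (N + 1) // k ≠ α})).hasFDerivAt.congr_fderiv ?_
        ext v
        simp only [sum_apply, smul_apply]
        symm
        rw [Finset.sum_eq_single ⟨n, h⟩]
        · simp
        · intro k _ hk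
          rw [MvPolynomial.pderiv_X_of_ne]
          · simp
          · exact fun h' => hk (Subtype.ext h'.symm)
        · simp
    have := hp.mul hX
    simp only [map_mul, MvPolynomial.eval_X]
    refine this.congr_fderiv ?_
    ext v
    simp only [sum_apply, smul_apply,
      add_apply, smul_eq_mul, Finset.mul_sum, ← Finset.sum_add_distrib]
    apply Finset.sum_congr rfl
    intro k _
    rw [Derivation.leibniz]
    simp only [smul_eq_mul, map_add, map_mul, MvPolynomial.eval_X]
    ring

/-- Sum over all indices, splitting off one of them. -/
theorem aux_sum_split {N : ℕ} (α : Fin (N + 1)) (g : Fin (N + 1) → ℂ) :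
    ∑ p, g p = g α + ∑ i : {k : Fin (N + 1) // k ≠ α}, g i := by
  rw [← Finset.add_sum_erase _ _ (Finset.mem_univ α)]
  congr 1
  exact Finset.sum_subtype _ (by simp) _

/-- **Equation (m23) of the paper.**

Complete-intersection chart setting: `F i` are homogeneous polynomials of degrees
`d i` in `Z_0, …, Z_N`; in the chart `U_α` (coordinates indexed by
`{k : Fin (N+1) // k ≠ α}`, with lift `ẑ_α = 1`) the dehomogenizations are
`F_i^α(z) = F_i(ẑ)`, the matrix `A = (∂F_i^α/∂z_{β_j})_{i,j≤s}` is invertible at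
the point `z` of `M_reg ∩ U_{αβ₁…β_s}` (where all `F_i^α` vanish),
`X̃^k(z) = a_{αk} + Σ_{i≠α} a_{ik} z_i - z_k (a_{αα} + Σ_{i≠α} a_{iα} z_i)` are the
chart components of the vector field `X = Σ a_{ij} Z_i ∂/∂Z_j`, which satisfies
`X F_i = Σ_j c_{ij} F_j` with `κ = trace c`, and `X̃F_i^α = Σ_{k≠α} X̃^k ∂F_i^α/∂z_k`.
Then `Σ_{i,j} (A⁻¹)_{ji} ∂(X̃F_i^α)/∂z_{β_j} = κ - (Σ_i d_i)(a_{αα} + Σ_{j≠α} a_{jα} z_j)`. -/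
theorem trace_of_action_in_chart
    (N s : ℕ) (hN : 1 ≤ N) (hs1 : 1 ≤ s) (hsN : s ≤ N)
    (a : Matrix (Fin (N + 1)) (Fin (N + 1)) ℂ)
    (htrace : Matrix.trace a = 0)
    (d : Fin s → ℕ) (F : Fin s → MvPolynomial (Fin (N + 1)) ℂ)
    (hF : ∀ i, (F i).IsHomogeneous (d i))
    (c : Matrix (Fin s) (Fin s) ℂ)
    (hXF : ∀ i, (∑ p, ∑ q, MvPolynomial.C (a p q) * MvPolynomial.X p *
        MvPolynomial.pderiv q (F i))
      = ∑ j, MvPolynomial.C (c i j) * F j)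
    (α : Fin (N + 1))
    (β : Fin s → {k : Fin (N + 1) // k ≠ α}) (hβ : Function.Injective β)
    (hat : ({k : Fin (N + 1) // k ≠ α} → ℂ) → (Fin (N + 1) → ℂ))
    (hhat : ∀ z j, hat z j = if h : j = α then 1 else z ⟨j, h⟩)
    (Xt : {k : Fin (N + 1) // k ≠ α} → ({k : Fin (N + 1) // k ≠ α} → ℂ) → ℂ)
    (hXt : ∀ k z, Xt k z =
      a α k + (∑ i : {k : Fin (N + 1) // k ≠ α}, a i k * z i)
        - z k * (a α α + ∑ i : {k : Fin (N + 1) // k ≠ α}, a i α * z i))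
    -- `X̃ F_i^α = Σ_{k ≠ α} X̃^k ∂F_i^α/∂z_k`
    (XtF : Fin s → ({k : Fin (N + 1) // k ≠ α} → ℂ) → ℂ)
    (hXtF : ∀ i z, XtF i z = ∑ k : {k : Fin (N + 1) // k ≠ α},
      Xt k z * fderiv ℂ (fun z' => MvPolynomial.eval (hat z') (F i)) z (Pi.single k 1))
    -- the matrix `A` as a function of the chart point
    (A : ({k : Fin (N + 1) // k ≠ α} → ℂ) → Matrix (Fin s) (Fin s) ℂ)
    (hA : ∀ z, A z = Matrix.of fun i j =>
      fderiv ℂ (fun z' => MvPolynomial.eval (hat z') (F i)) z (Pi.single (β j) 1)) :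
    ∀ z : {k : Fin (N + 1) // k ≠ α} → ℂ,
      (∀ i, MvPolynomial.eval (hat z) (F i) = 0) →
      IsUnit (A z).det →
      ∑ i, ∑ j, (A z)⁻¹ j i * fderiv ℂ (XtF i) z (Pi.single (β j) 1)
        = Matrix.trace c
          - (∑ i, (d i : ℂ)) *
              (a α α + ∑ j : {k : Fin (N + 1) // k ≠ α}, a j α * z j) := by
  intro z hz hdet
  have hderiv := aux_hasFDerivAt α hat hhat
  have hdir : ∀ i z k, fderiv ℂ (fun z' => MvPolynomial.eval (hat z') (F i)) z (Pi.single k 1)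
      = MvPolynomial.eval (hat z) (MvPolynomial.pderiv k.1 (F i)) := by
    intro i z k
    rw [(hderiv z (F i)).fderiv]
    simp [Pi.single_apply]
  have hatα : ∀ z, hat z α = 1 := fun z => by simp [hhat]
  have hatk : ∀ z (k : {k : Fin (N + 1) // k ≠ α}), hat z k = z k := fun z k => by
    simp [hhat, k.2]
  let L : ({k : Fin (N + 1) // k ≠ α} → ℂ) → ℂ := fun z =>
    a α α + ∑ i : {k : Fin (N + 1) // k ≠ α}, a i α * z i
  have hsum : ∀ z (q : Fin (N + 1)), ∑ p, a p q * hat z p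
      = a α q + ∑ i : {k : Fin (N + 1) // k ≠ α}, a i q * z i := by
    intro z q
    rw [aux_sum_split α]
    simp [hatα, hatk]
  have hX : ∀ i z, XtF i z = ∑ j, c i j * MvPolynomial.eval (hat z) (F j)
      - L z * ((d i : ℂ) * MvPolynomial.eval (hat z) (F i)) := by
    intro i z
    have h1 : ∑ q, (∑ p, a p q * hat z p) * MvPolynomial.eval (hat z) (MvPolynomial.pderiv q (F i))
        = ∑ j, c i j * MvPolynomial.eval (hat z) (F j) := by
      have := congrArg (MvPolynomial.eval (hat z)) (hXF i)
      simp only [map_sum, map_mul, MvPolynomial.eval_C, MvPolynomial.eval_X] at this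
      rw [← this, Finset.sum_comm]
      simp only [Finset.sum_mul]
    have h2 : ∑ q, hat z q * MvPolynomial.eval (hat z) (MvPolynomial.pderiv q (F i))
        = (d i : ℂ) * MvPolynomial.eval (hat z) (F i) := by
      have := congrArg (MvPolynomial.eval (hat z)) (hF i).sum_X_mul_pderiv
      simpa using this
    rw [← h1, ← h2, Finset.mul_sum, ← Finset.sum_sub_distrib, aux_sum_split α, hXtF]
    rw [hsum z α, hatα]
    simp only [L, one_mul, sub_self, zero_add]
    apply Finset.sum_congr rfl
    intro k _
    rw [hdir, hXt, hsum, hatk]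
    ring
  have hL : DifferentiableAt ℂ L z := by
    simp only [L]
    fun_prop
  have hfd : ∀ i, HasFDerivAt (fun z' => MvPolynomial.eval (hat z') (F i))
      (fderiv ℂ (fun z' => MvPolynomial.eval (hat z') (F i)) z) z := fun i =>
    (hderiv z (F i)).differentiableAt.hasFDerivAt
  have hD : ∀ i k, fderiv ℂ (XtF i) z (Pi.single (β k) 1)
      = (c * A z) i k - L z * (d i : ℂ) * A z i k := by
    intro i k
    have e : XtF i = fun z => ∑ j, c i j * MvPolynomial.eval (hat z) (F j)
      - L z * ((d i : ℂ) * MvPolynomial.eval (hat z) (F i)) := funext (hX i)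
    have h := (HasFDerivAt.fun_sum (𝕜 := ℂ) (u := Finset.univ)
      (fun j _ => (hfd j).const_mul (𝕜 := ℂ) (c i j))).fun_sub
      (hL.hasFDerivAt.fun_mul ((hfd i).const_mul (𝕜 := ℂ) (d i : ℂ)))
    rw [e, h.fderiv]
    simp [hz, hA, Matrix.mul_apply]
    ring
  have hinv : A z * (A z)⁻¹ = 1 := Matrix.mul_nonsing_inv _ hdet
  have hii : ∀ i, ∑ j, (A z)⁻¹ j i * fderiv ℂ (XtF i) z (Pi.single (β j) 1)
      = c i i - L z * (d i : ℂ) := by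
    intro i
    have e1 : ((c * A z) * (A z)⁻¹) i i = c i i := by
      rw [Matrix.mul_assoc, hinv, Matrix.mul_one]
    have e2 : (A z * (A z)⁻¹) i i = 1 := by rw [hinv, Matrix.one_apply_eq]
    rw [Matrix.mul_apply] at e1 e2
    calc _ = ∑ j, (c * A z) i j * (A z)⁻¹ j i
          - L z * (d i : ℂ) * ∑ j, A z i j * (A z)⁻¹ j i := by
          rw [Finset.mul_sum, ← Finset.sum_sub_distrib]
          apply Finset.sum_congr rfl
          intro j _
          rw [hD]; ring
      _ = _ := by rw [e1, e2, mul_one]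
  simp only [hii, Finset.sum_sub_distrib, ← Finset.mul_sum, Matrix.trace, Matrix.diag_apply]
  rw [mul_comm (L z)]
end

section
/- Let N ≥ 1 and let a = (a_{ij})_{0≤i,j≤N} be a complex (N+1)×(N+1) matrix with trace 0. For z = (z_1,…,z_N) ∈ ℂ^N let ẑ = (1, z_1, …, z_N) ∈ ℂ^{N+1}. Then the function z ↦ (Σ_{i,j=0}^N a_{ij} ẑ_i conj(ẑ_j)) / (1 + Σ_{k=1}^N |z_k|²)^{N+2} is Lebesgue-integrable on ℂ^N ≅ ℝ^{2N}, and its integral over ℂ^N equals 0. -/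
open scoped BigOperators ComplexConjugate

/-- `1 + |z|^2`. -/
noncomputable def fsQ {N : ℕ} (z : Fin N → ℂ) : ℝ := 1 + ∑ k, Complex.normSq (z k)

/-- `(1, z)`. -/
def fsHat {N : ℕ} (z : Fin N → ℂ) : Fin (N + 1) → ℂ := Fin.cons 1 z

lemma fsQ_ge_one {N : ℕ} (z : Fin N → ℂ) : 1 ≤ fsQ z := by
  have : 0 ≤ ∑ k, Complex.normSq (z k) := Finset.sum_nonneg fun k _ => Complex.normSq_nonneg _
  unfold fsQ; linarith

lemma fsQ_pos {N : ℕ} (z : Fin N → ℂ) : 0 < fsQ z := lt_of_lt_of_le one_pos (fsQ_ge_one z)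

lemma fsQ_eq_sum {N : ℕ} (z : Fin N → ℂ) : fsQ z = ∑ i, Complex.normSq (fsHat z i) := by
  simp [fsQ, fsHat, Fin.sum_univ_succ]

lemma continuous_fsQ {N : ℕ} : Continuous (fsQ (N := N)) := by
  unfold fsQ
  refine continuous_const.add (continuous_finsetSum _ fun k _ => ?_)
  exact Complex.continuous_normSq.comp (continuous_apply k)

lemma continuous_fsHat {N : ℕ} (i : Fin (N + 1)) :
    Continuous (fun z : Fin N → ℂ => fsHat z i) := by
  refine Fin.cases ?_ (fun k => ?_) i
  · simpa [fsHat] using continuous_const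
  · simpa [fsHat] using continuous_apply k

lemma norm_fsHat_le {N : ℕ} (z : Fin N → ℂ) (i : Fin (N + 1)) : ‖fsHat z i‖ ≤ √(fsQ z) := by
  apply Real.le_sqrt_of_sq_le
  rw [← Complex.normSq_eq_norm_sq, fsQ_eq_sum]
  exact Finset.single_le_sum (f := fun i => Complex.normSq (fsHat z i))
    (fun j _ => Complex.normSq_nonneg _) (Finset.mem_univ i)

lemma norm_sq_le_fsQ {N : ℕ} (z : Fin N → ℂ) : 1 + ‖z‖ ^ 2 ≤ fsQ z := by
  have h : ‖z‖ ≤ √(∑ k, Complex.normSq (z k)) := by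
    refine (pi_norm_le_iff_of_nonneg (Real.sqrt_nonneg _)).2 fun k => ?_
    apply Real.le_sqrt_of_sq_le
    rw [← Complex.normSq_eq_norm_sq]
    exact Finset.single_le_sum (f := fun i => Complex.normSq (z i))
      (fun j _ => Complex.normSq_nonneg _) (Finset.mem_univ k)
  have h0 : 0 ≤ ∑ k, Complex.normSq (z k) := Finset.sum_nonneg fun k _ => Complex.normSq_nonneg _
  have := (Real.le_sqrt (norm_nonneg _) h0).1 h
  unfold fsQ; linarith

lemma integrable_of_fs_bound {N : ℕ} {E : Type*} [NormedAddCommGroup E]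
    [SecondCountableTopologyEither (Fin N → ℂ) E]
    (h : (Fin N → ℂ) → E) (hc : Continuous h)
    (hb : ∀ z, ‖h z‖ * (√(fsQ z)) ^ (2 * N + 1) ≤ 1) :
    MeasureTheory.Integrable h MeasureTheory.volume := by
  have hr : (Module.finrank ℝ (Fin N → ℂ) : ℝ) < ((2 * N + 1 : ℕ) : ℝ) := by
    rw [Module.finrank_pi_fintype]
    simp [Complex.finrank_real_complex]
    linarith
  refine (integrable_rpow_neg_one_add_norm_sq (E := Fin N → ℂ)
    (μ := MeasureTheory.volume) hr).mono' hc.aestronglyMeasurable (Filter.Eventually.of_forall ?_)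
  intro z
  have h1 : (0 : ℝ) < 1 + ‖z‖ ^ 2 := by positivity
  have e : (1 + ‖z‖ ^ 2 : ℝ) ^ (-((2 * N + 1 : ℕ) : ℝ) / 2) =
      ((√(1 + ‖z‖ ^ 2)) ^ (2 * N + 1))⁻¹ := by
    rw [Real.sqrt_eq_rpow, ← Real.rpow_natCast (_ ^ (1 / 2 : ℝ)) (2 * N + 1), ← Real.rpow_mul h1.le, ← Real.rpow_neg h1.le]
    congr 1; ring
  rw [e]
  have hp : 0 < (√(1 + ‖z‖ ^ 2)) ^ (2 * N + 1) := pow_pos (Real.sqrt_pos.2 h1) _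
  rw [← one_div, le_div_iff₀ hp]
  refine le_trans ?_ (hb z)
  have := Real.sqrt_le_sqrt (norm_sq_le_fsQ z)
  gcongr

lemma fs_mul_le {N : ℕ} (z : Fin N → ℂ) (x : ℝ) (hx : |x| ≤ fsQ z) :
    ‖x / fsQ z ^ (N + 2)‖ * (√(fsQ z)) ^ (2 * N + 1) ≤ 1 := by
  have hs : 1 ≤ √(fsQ z) := Real.one_le_sqrt.2 (fsQ_ge_one z)
  have hq : fsQ z = √(fsQ z) ^ 2 := (Real.sq_sqrt (fsQ_pos z).le).symm
  have hQ := fsQ_pos z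
  rw [Real.norm_eq_abs, abs_div, abs_of_pos (pow_pos hQ (N + 2)), div_mul_eq_mul_div,
    div_le_one (pow_pos hQ _)]
  generalize √(fsQ z) = s at *
  rw [hq] at hx
  rw [hq]
  calc |x| * s ^ (2 * N + 1) ≤ s ^ 2 * s ^ (2 * N + 1) := by gcongr
    _ = s ^ (2 * N + 3) := by ring
    _ ≤ s ^ (2 * N + 4) := pow_le_pow_right₀ hs (by omega)
    _ = _ := by ring

lemma fs_integrable_real {N : ℕ} (g : (Fin N → ℂ) → ℝ) (hg : Continuous g)
    (hb : ∀ z, |g z| ≤ fsQ z) :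
    MeasureTheory.Integrable (fun z => g z / fsQ z ^ (N + 2)) MeasureTheory.volume :=
  integrable_of_fs_bound _ (hg.div (continuous_fsQ.pow _) fun z => (pow_pos (fsQ_pos z) _).ne')
    fun z => fs_mul_le z _ (hb z)

lemma fs_norm_mul_le {N : ℕ} (z : Fin N → ℂ) (i j : Fin (N + 1)) :
    ‖fsHat z i‖ * ‖fsHat z j‖ ≤ fsQ z := by
  calc _ ≤ √(fsQ z) * √(fsQ z) := by gcongr <;> exact norm_fsHat_le z _
    _ = _ := Real.mul_self_sqrt (fsQ_pos z).le

lemma fs_continuous_entry {N : ℕ} (i j : Fin (N + 1)) :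
    Continuous (fun z : Fin N → ℂ => fsHat z i * conj (fsHat z j) / ((fsQ z : ℝ) : ℂ) ^ (N + 2)) :=
  ((continuous_fsHat i).mul (Complex.continuous_conj.comp (continuous_fsHat j))).div
    ((Complex.continuous_ofReal.comp continuous_fsQ).pow _)
    fun z => pow_ne_zero _ (Complex.ofReal_ne_zero.2 (fsQ_pos z).ne')

lemma fs_integrable_entry {N : ℕ} (i j : Fin (N + 1)) :
    MeasureTheory.Integrable (fun z : Fin N → ℂ =>
      fsHat z i * conj (fsHat z j) / ((fsQ z : ℝ) : ℂ) ^ (N + 2)) MeasureTheory.volume := by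
  refine integrable_of_fs_bound _ (fs_continuous_entry i j) fun z => ?_
  have := fs_mul_le z (‖fsHat z i‖ * ‖fsHat z j‖)
    (by rw [abs_of_nonneg (by positivity)]; exact fs_norm_mul_le z i j)
  refine le_trans (le_of_eq ?_) this
  congr 1
  simp [abs_of_pos (fsQ_pos z)]

lemma fs_offdiag {N : ℕ} (i j : Fin (N + 1)) (hij : i ≠ j) :
    ∫ z : Fin N → ℂ, fsHat z i * conj (fsHat z j) / ((fsQ z : ℝ) : ℂ) ^ (N + 2) = 0 := by
  obtain ⟨k, hk⟩ : ∃ k : Fin N, (i = k.succ ∧ j ≠ k.succ) ∨ (j = k.succ ∧ i ≠ k.succ) := by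
    by_cases hi : i = 0
    · obtain ⟨k, hk⟩ := Fin.exists_succ_eq.2 (fun h : j = 0 => hij (hi.trans h.symm))
      exact ⟨k, Or.inr ⟨hk.symm, fun h => hij (h.trans hk)⟩⟩
    · obtain ⟨k, hk⟩ := Fin.exists_succ_eq.2 hi
      exact ⟨k, Or.inl ⟨hk.symm, fun h => hij (hk.symm.trans h.symm)⟩⟩
  let σ : (Fin N → ℂ) → (Fin N → ℂ) := fun z l => (if l = k then (fun w => -w) else id) (z l)
  have hσ : MeasureTheory.MeasurePreserving σ := by
    refine MeasureTheory.volume_preserving_pi (f := fun l => if l = k then (fun w => -w) else id)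
      fun l => ?_
    by_cases h : l = k
    · simpa [h] using MeasureTheory.Measure.measurePreserving_neg (MeasureTheory.volume : MeasureTheory.Measure ℂ)
    · simpa [h] using MeasureTheory.MeasurePreserving.id _
  have hQ : ∀ z, fsQ (σ z) = fsQ z := by
    intro z
    unfold fsQ
    congr 1
    refine Finset.sum_congr rfl fun l _ => ?_
    by_cases h : l = k <;> simp [σ, h]
  have h1 : ∀ z, fsHat (σ z) k.succ = - fsHat z k.succ := by
    intro z; simp [fsHat, σ]
  have h2 : ∀ z (l : Fin (N + 1)), l ≠ k.succ → fsHat (σ z) l = fsHat z l := by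
    intro z l
    refine Fin.cases ?_ (fun m => ?_) l
    · simp [fsHat]
    · intro h
      have : m ≠ k := fun e => h (by rw [e])
      simp [fsHat, σ, this]
  set F : (Fin N → ℂ) → ℂ :=
    fun z => fsHat z i * conj (fsHat z j) / ((fsQ z : ℝ) : ℂ) ^ (N + 2) with hF
  have hneg : ∀ z, F (σ z) = - F z := by
    intro z
    simp only [hF, hQ]
    rcases hk with ⟨rfl, hj⟩ | ⟨rfl, hi⟩
    · rw [h1, h2 z j hj]; ring
    · rw [h1, h2 z i hi, map_neg]; ring
  have hint : ∫ z, F (σ z) = ∫ z, F z := by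
    have := MeasureTheory.integral_map (μ := MeasureTheory.volume) hσ.measurable.aemeasurable
      (f := F) (fs_continuous_entry i j).aestronglyMeasurable
    rw [hσ.map_eq] at this
    exact this.symm
  simp only [hneg, MeasureTheory.integral_neg] at hint
  have : (2 : ℂ) * ∫ z, F z = 0 := by linear_combination -hint
  simpa using this

lemma fs_by_parts {N : ℕ} (k : Fin N) (u : ℂ) (hu : Complex.normSq u = 1) :
    2 * (N + 1) * ∫ z : Fin N → ℂ, (z k * conj u).re ^ 2 / fsQ z ^ (N + 2) =
      ∫ z : Fin N → ℂ, fsQ z / fsQ z ^ (N + 2) := by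
  have hun : ‖u‖ = 1 := by
    rw [Complex.normSq_eq_norm_sq] at hu
    nlinarith [norm_nonneg u]
  have hre : ∀ z : Fin N → ℂ, |(z k * conj u).re| ≤ √(fsQ z) := by
    intro z
    refine (Complex.abs_re_le_norm _).trans ?_
    rw [norm_mul, Complex.norm_conj, hun, mul_one]
    simpa [fsHat] using norm_fsHat_le z k.succ
  have hcre : Continuous fun z : Fin N → ℂ => (z k * conj u).re :=
    Complex.continuous_re.comp ((continuous_apply k).mul continuous_const)
  have hsq : ∀ z : Fin N → ℂ, (z k * conj u).re ^ 2 ≤ fsQ z := by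
    intro z
    rw [← sq_abs, ← Real.sq_sqrt (fsQ_pos z).le]
    gcongr
    exact hre z
  have hQline : ∀ (z : Fin N → ℂ) (t : ℝ), fsQ (z + t • (Pi.single k u : Fin N → ℂ)) =
      fsQ z + 2 * t * (z k * conj u).re + t ^ 2 := by
    intro z t
    have hterm : ∀ l, Complex.normSq ((z + t • (Pi.single k u : Fin N → ℂ)) l) =
        Complex.normSq (z l) + if l = k then 2 * t * (z k * conj u).re + t ^ 2 else 0 := by
      intro l
      by_cases h : l = k
      · subst h
        simp [Complex.normSq_add, hu]
        ring
      · simp [h]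
    simp only [fsQ, hterm, Finset.sum_add_distrib, Finset.sum_ite_eq', Finset.mem_univ, if_true]
    ring
  have key := integral_bilinear_hasLineDerivAt_right_eq_neg_left_of_integrable
    (μ := (MeasureTheory.volume : MeasureTheory.Measure (Fin N → ℂ)))
    (f := fun z : Fin N → ℂ => (z k * conj u).re) (f' := fun _ => 1)
    (g := fun z => (fsQ z ^ (N + 1))⁻¹)
    (g' := fun z => -(2 * (N + 1) * (z k * conj u).re) / fsQ z ^ (N + 2))
    (v := Pi.single k u) (B := ContinuousLinearMap.mul ℝ ℝ) ?_ ?_ ?_ ?_ ?_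
  · simp only [ContinuousLinearMap.mul_apply', one_mul] at key
    rw [← MeasureTheory.integral_const_mul]
    have e1 : ∀ z : Fin N → ℂ, fsQ z / fsQ z ^ (N + 2) = (fsQ z ^ (N + 1))⁻¹ := by
      intro z
      have := (fsQ_pos z).ne'
      field_simp
      ring
    simp only [e1]
    rw [← neg_eq_iff_eq_neg, ← MeasureTheory.integral_neg] at key
    rw [← key]
    congr 1
    ext z
    ring
  · have := fs_integrable_real (N := N) (fun z => fsQ z) continuous_fsQ
      (fun z => (abs_of_pos (fsQ_pos z)).le)
    refine this.congr (Filter.Eventually.of_forall fun z => ?_)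
    have := (fsQ_pos z).ne'
    simp only [ContinuousLinearMap.mul_apply', one_mul]
    field_simp
    ring
  · have := (fs_integrable_real (N := N) (fun z => (z k * conj u).re ^ 2) (hcre.pow 2)
      (fun z => by rw [abs_of_nonneg (sq_nonneg _)]; exact hsq z)).const_mul (-(2 * (N + 1)))
    refine this.congr (Filter.Eventually.of_forall fun z => ?_)
    simp only [ContinuousLinearMap.mul_apply']
    ring
  · refine integrable_of_fs_bound _ ?_ fun z => ?_
    · exact hcre.mul ((continuous_fsQ.pow _).inv₀ fun z => (pow_pos (fsQ_pos z) _).ne')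
    · simp only [ContinuousLinearMap.mul_apply']
      have hQ := fsQ_pos z
      rw [norm_mul, Real.norm_eq_abs, norm_inv, norm_pow, Real.norm_eq_abs, abs_of_pos hQ,
        ← div_eq_mul_inv, div_mul_eq_mul_div, div_le_one (pow_pos hQ _)]
      calc _ ≤ √(fsQ z) * √(fsQ z) ^ (2 * N + 1) := by gcongr; exact hre z
        _ = (√(fsQ z) ^ 2) ^ (N + 1) := by ring
        _ ≤ _ := by rw [Real.sq_sqrt hQ.le]
  · intro z _
    unfold HasLineDerivAt
    have : (fun t : ℝ => ((z + t • (Pi.single k u : Fin N → ℂ)) k * conj u).re) =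
        fun t : ℝ => (z k * conj u).re + t := by
      ext t
      have h2 : u.re * u.re + u.im * u.im = 1 := by simpa [Complex.normSq_apply] using hu
      simp
      linear_combination t * h2
    rw [this]
    simpa using (hasDerivAt_id (0 : ℝ)).const_add ((z k * conj u).re)
  · intro z _
    unfold HasLineDerivAt
    simp only [hQline]
    have hQ := (fsQ_pos z).ne'
    have h1 : HasDerivAt (fun t : ℝ => fsQ z + 2 * t * (z k * conj u).re + t ^ 2)
        (2 * (z k * conj u).re) 0 := by
      have a1 := ((((hasDerivAt_id (0 : ℝ)).const_mul 2).mul_const ((z k * conj u).re)).const_add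
        (fsQ z)).add (hasDerivAt_pow 2 (0 : ℝ))
      refine HasDerivAt.congr_deriv a1 ?_
      simp
    have h2 := (h1.pow (N + 1)).inv (by simpa using hQ)
    refine HasDerivAt.congr_deriv h2 ?_
    simp
    field_simp
    ring

lemma fs_diag_succ {N : ℕ} (k : Fin N) :
    (N + 1) * ∫ z : Fin N → ℂ, Complex.normSq (fsHat z k.succ) / fsQ z ^ (N + 2) =
      ∫ z : Fin N → ℂ, fsQ z / fsQ z ^ (N + 2) := by
  have h1 := fs_by_parts k 1 (by simp)
  have h2 := fs_by_parts k Complex.I (by simp)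
  have hle : ∀ z : Fin N → ℂ, (z k).re ^ 2 + (z k).im ^ 2 ≤ fsQ z := by
    intro z
    have := fs_norm_mul_le z k.succ k.succ
    rw [← sq, ← Complex.normSq_eq_norm_sq, Complex.normSq_apply] at this
    simp only [fsHat, Fin.cons_succ] at this
    linarith
  have i1 := fs_integrable_real (N := N) (fun z => (z k).re ^ 2) (by fun_prop)
    (fun z => by rw [abs_of_nonneg (sq_nonneg _)]; nlinarith [hle z, sq_nonneg (z k).im])
  have i2 := fs_integrable_real (N := N) (fun z => (z k).im ^ 2) (by fun_prop)
    (fun z => by rw [abs_of_nonneg (sq_nonneg _)]; nlinarith [hle z, sq_nonneg (z k).re])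
  have e : ∀ z : Fin N → ℂ, Complex.normSq (fsHat z k.succ) / fsQ z ^ (N + 2) =
      (z k).re ^ 2 / fsQ z ^ (N + 2) + (z k).im ^ 2 / fsQ z ^ (N + 2) := by
    intro z
    simp only [fsHat, Fin.cons_succ, Complex.normSq_apply]
    ring
  simp only [e]
  rw [MeasureTheory.integral_add i1 i2]
  simp at h1 h2
  linarith

lemma fs_diag {N : ℕ} (i : Fin (N + 1)) :
    (N + 1) * ∫ z : Fin N → ℂ, Complex.normSq (fsHat z i) / fsQ z ^ (N + 2) =
      ∫ z : Fin N → ℂ, fsQ z / fsQ z ^ (N + 2) := by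
  have hi : ∀ j : Fin (N + 1), MeasureTheory.Integrable
      (fun z : Fin N → ℂ => Complex.normSq (fsHat z j) / fsQ z ^ (N + 2)) := fun j =>
    fs_integrable_real _ (Complex.continuous_normSq.comp (continuous_fsHat j)) fun z => by
      rw [abs_of_nonneg (Complex.normSq_nonneg _), Complex.normSq_eq_norm_sq, sq]
      exact fs_norm_mul_le z j j
  refine Fin.cases ?_ (fun k => fs_diag_succ k) i
  have hs : ∫ z : Fin N → ℂ, fsQ z / fsQ z ^ (N + 2) =
      ∑ j, ∫ z : Fin N → ℂ, Complex.normSq (fsHat z j) / fsQ z ^ (N + 2) := by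
    rw [← MeasureTheory.integral_finsetSum _ fun j _ => hi j]
    congr 1
    ext z
    rw [← Finset.sum_div, ← fsQ_eq_sum]
  rw [Fin.sum_univ_succ] at hs
  have hN : (N + 1 : ℝ) ≠ 0 := by positivity
  have h3 : ∀ k : Fin N, ∫ z : Fin N → ℂ, Complex.normSq (fsHat z k.succ) / fsQ z ^ (N + 2) =
      (∫ z : Fin N → ℂ, fsQ z / fsQ z ^ (N + 2)) / (N + 1) := by
    intro k
    rw [← fs_diag_succ k]
    field_simp
  simp only [h3, Finset.sum_const, Finset.card_univ, Fintype.card_fin, nsmul_eq_mul] at hs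
  field_simp at hs
  linarith

lemma fs_entry {N : ℕ} (i j : Fin (N + 1)) :
    ∫ z : Fin N → ℂ, fsHat z i * conj (fsHat z j) / ((fsQ z : ℝ) : ℂ) ^ (N + 2) =
      if i = j then (((∫ z : Fin N → ℂ, fsQ z / fsQ z ^ (N + 2)) / (N + 1) : ℝ) : ℂ) else 0 := by
  split_ifs with h
  · subst h
    have hN : (N + 1 : ℝ) ≠ 0 := by positivity
    rw [← fs_diag i, mul_div_cancel_left₀ _ hN, ← integral_complex_ofReal]
    congr 1
    ext z
    rw [Complex.mul_conj]
    push_cast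
    rfl
  · exact fs_offdiag i j h

/-- **The explicit-coordinate form of `∫_{CP^N} θ ω_FS^N = 0`** (used in the proof of
Lemma 5.1 of the paper).

For a traceless complex `(N+1) × (N+1)` matrix `a` and `ẑ = (1, z_1, …, z_N)`,
the function `z ↦ (Σ_{i,j} a_{ij} ẑ_i conj(ẑ_j)) / (1 + ‖z‖²)^{N+2}` is
Lebesgue-integrable on `ℂ^N` and its integral vanishes. -/
theorem integral_theta_fubini_study_zero
    (N : ℕ) (hN : 1 ≤ N)
    (a : Matrix (Fin (N + 1)) (Fin (N + 1)) ℂ)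
    (htrace : Matrix.trace a = 0)
    (f : (Fin N → ℂ) → ℂ)
    (hf : ∀ z, f z =
      (∑ i, ∑ j, a i j * (Fin.cons 1 z : Fin (N + 1) → ℂ) i *
          conj ((Fin.cons 1 z : Fin (N + 1) → ℂ) j))
        / (((1 + ∑ k, Complex.normSq (z k) : ℝ) : ℂ)) ^ (N + 2)) :
    MeasureTheory.Integrable f MeasureTheory.volume ∧
      ∫ z : Fin N → ℂ, f z = 0 := by
  have hf' : f = fun z => ∑ i, ∑ j, a i j *
      (fsHat z i * conj (fsHat z j) / ((fsQ z : ℝ) : ℂ) ^ (N + 2)) := by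
    ext z
    rw [hf, Finset.sum_div]
    refine Finset.sum_congr rfl fun i _ => ?_
    rw [Finset.sum_div]
    refine Finset.sum_congr rfl fun j _ => ?_
    simp only [fsHat, fsQ]
    ring
  have hi : ∀ i j, MeasureTheory.Integrable (fun z : Fin N → ℂ => a i j *
      (fsHat z i * conj (fsHat z j) / ((fsQ z : ℝ) : ℂ) ^ (N + 2))) MeasureTheory.volume :=
    fun i j => (fs_integrable_entry i j).const_mul _
  have hi' : ∀ i, MeasureTheory.Integrable (fun z : Fin N → ℂ => ∑ j, a i j *
      (fsHat z i * conj (fsHat z j) / ((fsQ z : ℝ) : ℂ) ^ (N + 2))) MeasureTheory.volume :=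
    fun i => MeasureTheory.integrable_finsetSum _ fun j _ => hi i j
  subst hf'
  refine ⟨MeasureTheory.integrable_finsetSum _ fun i _ => hi' i, ?_⟩
  rw [MeasureTheory.integral_finsetSum _ fun i _ => hi' i]
  have : ∀ i, ∫ z : Fin N → ℂ, ∑ j, a i j *
      (fsHat z i * conj (fsHat z j) / ((fsQ z : ℝ) : ℂ) ^ (N + 2)) =
      a i i * (((∫ z : Fin N → ℂ, fsQ z / fsQ z ^ (N + 2)) / (N + 1) : ℝ) : ℂ) := by
    intro i
    rw [MeasureTheory.integral_finsetSum _ fun j _ => hi i j]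
    simp only [MeasureTheory.integral_const_mul, fs_entry]
    simp
  simp only [this]
  rw [← Finset.sum_mul]
  have ht : ∑ i, a i i = 0 := htrace
  rw [ht, zero_mul]
end
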